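/- Let Δ be a simplicial complex with dim Δ = 1. Then the sequence (depth(S/I_Δ^(ℓ)))_{ℓ≥1} equals (2,2,2,…) if Δ is a matroid complex; (2,2,1,1,…) if diam Δ ≤ 2 and Δ is not a matroid complex; (2,1,1,…) if 3 ≤ diam Δ < ∞; and (1,1,1,…) if diam Δ = ∞. Moreover, if Δ is pure, then (S_2-depth(S/I_Δ^(ℓ)))_{ℓ≥1} = (depth(S/I_Δ^(ℓ)))_{ℓ≥1}. -/

import Mathlib

/-!
Common definitions for formalizing "The Serre depth of Stanley–Reisner rings and
the depth of their symbolic powers" (Muta–Terai).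
-/

open CategoryTheory MvPolynomial

noncomputable section

namespace SerrePaper

/-! ### Simplicial complexes (given by their sets of faces) -/

variable {V : Type}

/-- A (nonempty, downward closed) abstract simplicial complex, given by its set of faces. -/
def IsComplex (K : Set (Finset V)) : Prop :=
  K.Nonempty ∧ ∀ F ∈ K, ∀ G ⊆ F, G ∈ K

/-- `F` is a facet (maximal face) of `K`. -/
def IsFacet (K : Set (Finset V)) (F : Finset V) : Prop :=
  F ∈ K ∧ ∀ G ∈ K, F ⊆ G → G = F

/-- `K` is pure: all facets have the same cardinality. -/
def Pure (K : Set (Finset V)) : Prop :=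
  ∀ F G : Finset V, IsFacet K F → IsFacet K G → F.card = G.card

/-- `dim K = d - 1`, i.e. the maximal cardinality of a face of `K` is `d`. -/
def HasDimCard (K : Set (Finset V)) (d : ℕ) : Prop :=
  (∃ F ∈ K, F.card = d) ∧ ∀ F ∈ K, F.card ≤ d

/-- the link of the face `F` in `K`. -/
def link [DecidableEq V] (K : Set (Finset V)) (F : Finset V) : Set (Finset V) :=
  { G | G ∪ F ∈ K ∧ G ∩ F = ∅ }

/-- `skeleton K t` is the `(t-1)`-skeleton `K^{t-1}` of `K`:
all faces with at most `t` vertices. -/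
def skeleton (K : Set (Finset V)) (t : ℕ) : Set (Finset V) :=
  { F ∈ K | F.card ≤ t }

/-- The Alexander dual complex `K^∨ = { F | complement of F is not a face of K }`. -/
def dualComplex [Fintype V] [DecidableEq V] (K : Set (Finset V)) : Set (Finset V) :=
  { F | Fᶜ ∉ K }

/-- The copy of `K` on its own vertex set (as a complex on the corresponding subtype). -/
def restrictVerts (K : Set (Finset V)) : Set (Finset {v : V // {v} ∈ K}) :=
  { F | F.map (Function.Embedding.subtype _) ∈ K }

/-- The induced subcomplex `K_W` on a subset `W` of the vertices. -/
def inducedSub (K : Set (Finset V)) (W : Finset V) : Set (Finset V) :=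
  { F ∈ K | F ⊆ W }

/-- `K` is a matroid complex: every induced subcomplex is pure. -/
def IsMatroidComplex (K : Set (Finset V)) : Prop :=
  ∀ W : Finset V, Pure (inducedSub K W)

/-! ### Reduced simplicial homology with coefficients in a field `k` -/

/-- The group of simplicial `(c-1)`-chains: formal `k`-linear combinations of the
faces of `K` with exactly `c` vertices. -/
abbrev chainGroup (k : Type) [Field k] (K : Set (Finset V)) (c : ℕ) : Type :=
  {F : Finset V // F ∈ K ∧ F.card = c} →₀ k

open Classical in
/-- the boundary of a single face, `∂F = ∑_{x ∈ F} (-1)^{pos of x in F} (F \ {x})`. -/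
def boundaryAt (k : Type) [Field k] [LinearOrder V] (K : Set (Finset V)) (c : ℕ)
    (F : {F : Finset V // F ∈ K ∧ F.card = c + 1}) : chainGroup k K c :=
  ∑ x ∈ F.1.attach,
    if h : F.1.erase x.1 ∈ K then
      Finsupp.single
        ⟨F.1.erase x.1, h, by simp [Finset.card_erase_of_mem x.2, F.2.2]⟩
        ((-1 : k) ^ (F.1.filter (fun y => y < x.1)).card)
    else 0

/-- The simplicial boundary map (for a downward closed `K` this is the usual
boundary map of the reduced (augmented) chain complex of `K`, where faces with
`c` vertices sit in homological degree `c - 1`). -/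
def boundary (k : Type) [Field k] [LinearOrder V] (K : Set (Finset V)) (c : ℕ) :
    chainGroup k K (c + 1) →ₗ[k] chainGroup k K c :=
  Finsupp.lsum k fun F => LinearMap.toSpanSingleton k _ (boundaryAt k K c F)

/-- `H̃ᵢ(K; k) = 0`: every reduced `i`-cycle is a boundary.  (For `i ≤ -2` this holds
trivially; for `i = -1` the relevant cycle group is the whole of the `(-1)`-chains.) -/
def reducedHomologyVanishes (k : Type) [Field k] [LinearOrder V]
    (K : Set (Finset V)) (i : ℤ) : Prop :=
  if i < -1 then True
  else if i = -1 then
    ∀ z : chainGroup k K 0, ∃ b : chainGroup k K 1, boundary k K 0 b = z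
  else
    ∀ z : chainGroup k K (i.toNat + 1), boundary k K i.toNat z = 0 →
      ∃ b : chainGroup k K (i.toNat + 2), boundary k K (i.toNat + 1) b = z

/-- Nonvanishing `β_{i,j}(k[K]) ≠ 0` of the graded Betti numbers of the
Stanley–Reisner ring of `K`, expressed via Hochster's formula:
`β_{i,j}(k[K]) = ∑_{W ⊆ V, |W| = j} dim_k H̃_{j-i-1}(K_W; k)`. -/
def bettiNonzero (k : Type) [Field k] [LinearOrder V] (K : Set (Finset V)) (i j : ℕ) : Prop :=
  ∃ W : Finset V, W.card = j ∧
    ¬ reducedHomologyVanishes k (inducedSub K W) ((j : ℤ) - i - 1)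

/-- `reg_{≤ r} I_K = max{ j : β_{i,i+j}(I_K) ≠ 0 for some i ≤ r }`, where
`β_{i,d}(I_K) = β_{i+1,d}(k[K])`. -/
def regLEIdeal (k : Type) [Field k] [LinearOrder V] (K : Set (Finset V)) (r : ℕ) : ℕ :=
  sSup { j : ℕ | ∃ i ≤ r, bettiNonzero k K (i + 1) (i + j) }

/-- `indeg I_K`: the least degree of a minimal generator of the Stanley–Reisner
ideal of `K`, i.e. `min{ j : β_{0,j}(I_K) = β_{1,j}(k[K]) ≠ 0 }`. -/
def indegIdeal (k : Type) [Field k] [LinearOrder V] (K : Set (Finset V)) : ℕ :=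
  sInf { j : ℕ | bettiNonzero k K 1 j }

/-! ### Stanley–Reisner rings, Serre depth, depth, symbolic powers -/

variable (k : Type) [Field k]

/-- The Stanley–Reisner ideal of `K` (generated by the monomials of the non-faces,
equivalently by those of the minimal non-faces). -/
def srIdeal (K : Set (Finset V)) : Ideal (MvPolynomial V k) :=
  Ideal.span { m | ∃ F : Finset V, F ∉ K ∧ m = ∏ i ∈ F, X i }

/-- The homogeneous maximal ideal `(x_v : v ∈ V)` of the polynomial ring. -/
def maxIdeal (V : Type) : Ideal (MvPolynomial V k) :=
  Ideal.span (Set.range X)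

/-- The quotient ring `S/I` as an object of `ModuleCat S`. -/
def quotMod {V : Type} (I : Ideal (MvPolynomial V k)) : ModuleCat (MvPolynomial V k) :=
  ModuleCat.of _ (MvPolynomial V k ⧸ I)

/-- The Stanley–Reisner ring `k[K] = S/I_K` as a module over `S`. -/
def srRing (K : Set (Finset V)) : ModuleCat (MvPolynomial V k) :=
  quotMod k (srIdeal k K)

/-- The Krull dimension of a module, `dim M = dim (R / ann M)` (so `dim 0 = ⊥ = -∞`). -/
def modDim {R : Type} [CommRing R] (M : ModuleCat R) : WithBot ℕ∞ :=
  ringKrullDim (R ⧸ Module.annihilator R M)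

/-- `Ext_R^i(M, N)` as an `R`-module. -/
def extM {R : Type} [CommRing R] (M N : ModuleCat R) (i : ℕ) : ModuleCat R :=
  ((Ext R (ModuleCat R) i).obj (Opposite.op M)).obj N

/-- `K_M^j = Ext_S^{n-j}(M, ω_S)`, the (Matlis dual of) local cohomology; since the
canonical module `ω_S` of the polynomial ring `S` is `S` itself up to a
grading shift, we use `Ext_S^{n-j}(M, S)`. -/
def serreK {V : Type} (M : ModuleCat (MvPolynomial V k)) (j : ℕ) :
    ModuleCat (MvPolynomial V k) :=
  extM M (ModuleCat.of _ (MvPolynomial V k)) (Nat.card V - j)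

/-- The Serre depth `S_r-depth(M) = min{ j : dim K_M^j ≥ j - r + 1 }`.
(Note that, since `dim K_M^j` is either `⊥` or `≥ 0`, the inequality
`dim K_M^j ≥ j - r + 1` of (possibly negative) integers is equivalent to
`(j + 1 - r : ℕ) ≤ dim K_M^j` with truncated subtraction.) -/
def serreDepth {V : Type} (r : ℕ) (M : ModuleCat (MvPolynomial V k)) : ℕ :=
  sInf { j : ℕ | ((j + 1 - r : ℕ) : WithBot ℕ∞) ≤ modDim (serreK k M j) }

/-- Serre's condition `(S_r)` for an unmixed module: `S_r-depth(M) = dim M`. -/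
def serreCond {V : Type} (r : ℕ) (M : ModuleCat (MvPolynomial V k)) : Prop :=
  (serreDepth k r M : WithBot ℕ∞) = modDim M

/-- The depth of `M` with respect to the homogeneous maximal ideal,
via Rees' characterization `depth M = min{ i : Ext^i(S/m, M) ≠ 0 }`. -/
def mdepth {V : Type} (M : ModuleCat (MvPolynomial V k)) : ℕ :=
  sInf { i : ℕ | Nontrivial (extM (quotMod k (maxIdeal k V)) M i) }

/-- `M` is Cohen–Macaulay: `depth M = dim M`. -/
def isCM {V : Type} (M : ModuleCat (MvPolynomial V k)) : Prop :=
  (mdepth k M : WithBot ℕ∞) = modDim M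

/-- The `ℓ`-th symbolic power of a (radical, e.g. squarefree monomial) ideal:
`I^(ℓ) = ⋂_{P ∈ Min(I)} P^ℓ`. -/
def symbPow {R : Type} [CommRing R] (I : Ideal R) (ℓ : ℕ) : Ideal R :=
  sInf { J | ∃ P ∈ I.minimalPrimes, J = P ^ ℓ }

/-- The height of an ideal: the Krull dimension of the poset of primes contained in it. -/
def idealHeight {R : Type} [CommRing R] (p : Ideal R) : WithBot ℕ∞ :=
  Order.krullDim { q : PrimeSpectrum R // q.asIdeal ≤ p }

/-- `R/I` is unmixed: all associated primes of `R/I` have the same height. -/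
def IsUnmixedIdeal {R : Type} [CommRing R] (I : Ideal R) : Prop :=
  ∀ p q : Ideal R, p ∈ associatedPrimes R (R ⧸ I) → q ∈ associatedPrimes R (R ⧸ I) →
    idealHeight p = idealHeight q

/-- Nonvanishing of the first local cohomology `H_m^1(S/I) ≠ 0`. -/
def H1NE {V : Type} (I : Ideal (MvPolynomial V k)) : Prop :=
  Nontrivial ((localCohomology (maxIdeal k V) 1).obj (quotMod k I))

/-- `I` is a squarefree monomial ideal. -/
def IsSqFreeMonomialIdeal {V : Type} (I : Ideal (MvPolynomial V k)) : Prop :=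
  ∃ G : Set (Finset V), I = Ideal.span ((fun F => ∏ i ∈ F, X i) '' G)

end SerrePaper

end
namespace SerrePaper

/-- The 1-skeleton of `K` has diameter at most 2. -/
def diamLE2 {V : Type} [DecidableEq V] (K : Set (Finset V)) : Prop :=
  ∀ u w : V, {u} ∈ K → {w} ∈ K →
    u = w ∨ ({u, w} : Finset V) ∈ K ∨ ∃ z : V, ({u, z} : Finset V) ∈ K ∧ ({z, w} : Finset V) ∈ K

/-- `K` is connected (as a graph): any two vertices are joined by a path of edges,
i.e. `diam K < ∞`. -/
def oneConnected {V : Type} [DecidableEq V] (K : Set (Finset V)) : Prop :=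
  ∀ u w : V, {u} ∈ K → {w} ∈ K →
    Relation.ReflTransGen (fun a b : V => a ≠ b ∧ ({a, b} : Finset V) ∈ K) u w

set_option linter.unusedSectionVars false

noncomputable section

section ExtComparison

variable {R : Type} [CommRing R] {M N : ModuleCat.{0} R}

lemma extMk_zero_deg_eq_zero (P : ProjectiveResolution M) (f : P.complex.X 0 ⟶ N)
    (hf : P.complex.d 1 0 ≫ f = 0) (h : P.extMk f 1 rfl hf = 0) : f = 0 := by
  rw [← P.extEquivCohomologyClass.apply_eq_iff_eq,
    P.extEquivCohomologyClass_extMk, P.extEquivCohomologyClass_zero,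
    CochainComplex.HomComplex.CohomologyClass.mk_eq_zero_iff] at h
  rw [CochainComplex.HomComplex.Cocycle.toSingleMk_mem_coboundaries_iff _ _ _ _ _ 1 (by simp)] at h
  obtain ⟨g, hg⟩ := h
  have hz : Limits.IsZero (P.cochainComplex.X 1) := by
    dsimp [ProjectiveResolution.cochainComplex]
    exact HomologicalComplex.isZero_extend_X _ _ _ (fun i => by
      rw [ComplexShape.embeddingDownNat_f]
      lia)
  rw [hz.eq_of_src g 0, Limits.comp_zero] at hg
  rw [← cancel_epi (P.cochainComplexXIso (-0) 0 rfl).hom, Limits.comp_zero]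
  exact hg.symm

lemma extMk_smul (P : ProjectiveResolution M) {n : ℕ} (r : R) (f : P.complex.X n ⟶ N)
    (hf : P.complex.d (n + 1) n ≫ f = 0) :
    P.extMk (r • f) (n + 1) rfl (by rw [Linear.comp_smul, hf, smul_zero]) =
      r • P.extMk f (n + 1) rfl hf := by
  rw [Abelian.Ext.smul_eq_comp_mk₀, P.extMk_comp_mk₀]
  congr 1

variable (N) in
/-- The piece of the Hom complex computing `Ext^n`. -/
abbrev homComplexAt (P : ProjectiveResolution M) (i n : ℕ) : ShortComplex (ModuleCat R) :=
  (P.complex.linearYonedaObj R N).sc' i n (n + 1)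

/-- Cocycles of the Hom complex, sent to their extension classes. -/
def cocycleToExt (P : ProjectiveResolution M) (N : ModuleCat.{0} R) (i n : ℕ) :
    LinearMap.ker (homComplexAt N P i n).g.hom →ₗ[R] Abelian.Ext M N n where
  toFun f := P.extMk (Y := N) f.1 (n + 1) rfl (by
    have := f.2
    rw [LinearMap.mem_ker] at this
    exact this)
  map_add' f g := (P.add_extMk _ _ _ _ _ _).symm
  map_smul' r f := extMk_smul P r _ _

lemma cocycleToExt_surjective (P : ProjectiveResolution M) (i n : ℕ) :
    Function.Surjective (cocycleToExt P N i n) := by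
  intro α
  obtain ⟨f, hf, rfl⟩ := P.extMk_surjective α (n + 1) rfl
  exact ⟨⟨f, LinearMap.mem_ker.2 hf⟩, rfl⟩

lemma ker_cocycleToExt (P : ProjectiveResolution M) (i n : ℕ) (hi : ∀ m, m + 1 = n → m = i) :
    LinearMap.ker (cocycleToExt P N i n) =
      LinearMap.range (homComplexAt N P i n).moduleCatToCycles := by
  ext ⟨f, hf⟩
  rw [LinearMap.mem_ker, LinearMap.mem_range]
  cases n with
  | zero =>
    constructor
    · intro h
      have h0 : f = 0 := extMk_zero_deg_eq_zero P f (LinearMap.mem_ker.1 hf) h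
      exact ⟨0, Subtype.ext (by rw [map_zero]; exact h0.symm)⟩
    · rintro ⟨g, hg⟩
      have hd : (P.complex.linearYonedaObj R N).d i 0 = 0 :=
        HomologicalComplex.shape _ _ _ (by simp)
      have h0 : f = 0 := by
        refine (congrArg Subtype.val hg).symm.trans ?_
        change ((P.complex.linearYonedaObj R N).d i 0).hom g = 0
        rw [hd]
        rfl
      subst h0
      exact P.extMk_zero _ rfl
  | succ m =>
    obtain rfl := hi m rfl
    refine (P.extMk_eq_zero_iff f _ rfl (LinearMap.mem_ker.1 hf) m rfl).trans ?_
    constructor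
    · rintro ⟨g, hg⟩
      exact ⟨g, Subtype.ext hg⟩
    · rintro ⟨g, hg⟩
      exact ⟨g, congrArg Subtype.val hg⟩

variable (M N) in
/-- The two models of `Ext` (derived functor and derived category) agree. -/
def extMEquiv (n : ℕ) : extM M N n ≃ₗ[R] Abelian.Ext M N n :=
  let P := projectiveResolution M
  let C := P.complex.linearYonedaObj R N
  let i := (ComplexShape.up ℕ).prev n
  let e₁ : extM M N n ≅ (homComplexAt N P i n).moduleCatLeftHomologyData.H :=
    P.isoExt n N ≪≫ ShortComplex.homologyMapIso (C.isoSc' _ n (n + 1) rfl (by simp)) ≪≫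
      ShortComplex.moduleCatHomologyIso _
  e₁.toLinearEquiv ≪≫ₗ
    Submodule.quotEquivOfEq _ _ (ker_cocycleToExt P i n fun m hm => by subst hm; simp [i]).symm ≪≫ₗ
    LinearMap.quotKerEquivOfSurjective _ (cocycleToExt_surjective P i n)

lemma nontrivial_extM_iff (n : ℕ) : Nontrivial (extM M N n) ↔ Nontrivial (Abelian.Ext M N n) :=
  (extMEquiv M N n).toEquiv.nontrivial_congr

lemma annihilator_extM (n : ℕ) :
    Module.annihilator R (extM M N n) = Module.annihilator R (Abelian.Ext M N n) :=
  (extMEquiv M N n).annihilator_eq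

end ExtComparison

section LongExact

variable {R : Type} [CommRing R] {S : ShortComplex (ModuleCat.{0} R)}

lemma ext_nontrivial_X₁ (hS : S.ShortExact) (A : ModuleCat.{0} R) {i : ℕ}
    (h₂ : Subsingleton (Abelian.Ext A S.X₂ i))
    (h₃ : Nontrivial (Abelian.Ext A S.X₃ i)) : Nontrivial (Abelian.Ext A S.X₁ (i + 1)) := by
  obtain ⟨y, hy⟩ := exists_ne (0 : Abelian.Ext A S.X₃ i)
  refine ⟨⟨y.comp hS.extClass rfl, 0, fun h => hy ?_⟩⟩
  obtain ⟨x, rfl⟩ := Abelian.Ext.covariant_sequence_exact₃ A hS y rfl h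
  rw [Subsingleton.elim x 0, Abelian.Ext.zero_comp]

lemma ext_contra_nontrivial_X₁ (hS : S.ShortExact) (B : ModuleCat.{0} R) {i : ℕ}
    (h₂ : Subsingleton (Abelian.Ext S.X₂ B (i + 1)))
    (h₃ : Nontrivial (Abelian.Ext S.X₃ B (i + 1))) : Nontrivial (Abelian.Ext S.X₁ B i) := by
  obtain ⟨y, hy⟩ := exists_ne (0 : Abelian.Ext S.X₃ B (i + 1))
  obtain ⟨x, rfl⟩ := Abelian.Ext.contravariant_sequence_exact₃ hS B y
    (Subsingleton.elim _ _) (add_comm 1 i)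
  refine ⟨⟨x, 0, ?_⟩⟩
  rintro rfl
  exact hy (Abelian.Ext.comp_zero _ _ _ _ _)

lemma ext_contra_precomp_surjective (hS : S.ShortExact) (B : ModuleCat.{0} R) {i : ℕ}
    (h₃ : Subsingleton (Abelian.Ext S.X₃ B (i + 1))) (x : Abelian.Ext S.X₁ B i) :
    ∃ y : Abelian.Ext S.X₂ B i, (Abelian.Ext.mk₀ S.f).comp y (zero_add i) = x :=
  Abelian.Ext.contravariant_sequence_exact₁ hS B x (add_comm 1 i) (Subsingleton.elim _ _)

lemma ext_contra_nontrivial_X₂ (hS : S.ShortExact) (B : ModuleCat.{0} R) {i : ℕ}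
    (h₁ : Nontrivial (Abelian.Ext S.X₁ B i))
    (h₃ : Subsingleton (Abelian.Ext S.X₃ B (i + 1))) : Nontrivial (Abelian.Ext S.X₂ B i) := by
  obtain ⟨x, hx⟩ := exists_ne (0 : Abelian.Ext S.X₁ B i)
  obtain ⟨y, rfl⟩ := ext_contra_precomp_surjective hS B h₃ x
  refine ⟨⟨y, 0, ?_⟩⟩
  rintro rfl
  exact hx (Abelian.Ext.comp_zero _ _ _ _ _)

end LongExact

section Cyclic

variable {R : Type} [CommRing R]

/-- The cyclic module `R/I`. -/
abbrev cyc (I : Ideal R) : ModuleCat.{0} R := ModuleCat.of R (R ⧸ I)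

/-- Multiplication by `x` as a map `R/I → R/J`. -/
def mulMap (I J : Ideal R) (x : R) (h : ∀ p ∈ I, x * p ∈ J) : cyc I ⟶ cyc J :=
  ModuleCat.ofHom (Submodule.mapQ I J (LinearMap.mulLeft R x) h)

lemma mulMap_comp (I J L : Ideal R) (x y : R) (h : ∀ p ∈ I, x * p ∈ J) (h' : ∀ p ∈ J, y * p ∈ L)
    (h'' : ∀ p ∈ I, (y * x) * p ∈ L) :
    mulMap I J x h ≫ mulMap J L y h' = mulMap I L (y * x) h'' := by
  refine ModuleCat.hom_ext (LinearMap.ext fun q => ?_)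
  change R ⧸ I at q
  obtain ⟨p, rfl⟩ := Submodule.Quotient.mk_surjective I q
  change (Submodule.Quotient.mk (y * (x * p)) : R ⧸ L) = Submodule.Quotient.mk ((y * x) * p)
  rw [mul_assoc]

lemma mulMap_self (I : Ideal R) (x : R) (h : ∀ p ∈ I, x * p ∈ I) :
    mulMap I I x h = x • 𝟙 (cyc I) := by
  refine ModuleCat.hom_ext (LinearMap.ext fun q => ?_)
  change R ⧸ I at q
  obtain ⟨p, rfl⟩ := Submodule.Quotient.mk_surjective I q
  rfl

lemma smul_id_comp {X Y : ModuleCat.{0} R} (x : R) {n : ℕ} (e : Abelian.Ext X Y n) :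
    (Abelian.Ext.mk₀ (x • 𝟙 X)).comp e (zero_add n) = x • e := by
  rw [Abelian.Ext.mk₀_smul, Abelian.Ext.smul_comp, Abelian.Ext.mk₀_id_comp]

lemma mulMap_precomp (I : Ideal R) (x : R) (h : ∀ p ∈ I, x * p ∈ I) {Y : ModuleCat.{0} R} {n : ℕ}
    (e : Abelian.Ext (cyc I) Y n) :
    (Abelian.Ext.mk₀ (mulMap I I x h)).comp e (zero_add n) = x • e := by
  rw [mulMap_self, smul_id_comp]

/-- The sequence `0 → R/(I : x) → R/I → R/(I + x) → 0`. -/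
def colonSeq (I' I I'' : Ideal R) (x : R) (h : ∀ p, p ∈ I' ↔ x * p ∈ I)
    (h' : I'' = I ⊔ Ideal.span {x}) : ShortComplex (ModuleCat.{0} R) where
  X₁ := cyc I'
  X₂ := cyc I
  X₃ := cyc I''
  f := mulMap I' I x fun p hp => (h p).1 hp
  g := mulMap I I'' 1 fun p hp => by
    rw [one_mul, h']
    exact Ideal.mem_sup_left hp
  zero := by
    rw [mulMap_comp (h'' := fun p _ => by
      rw [h', one_mul]
      exact Ideal.mem_sup_right (Ideal.mul_mem_right _ _ (Ideal.mem_span_singleton_self x)))]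
    refine ModuleCat.hom_ext (LinearMap.ext fun q => ?_)
    change R ⧸ I' at q
    obtain ⟨p, rfl⟩ := Submodule.Quotient.mk_surjective I' q
    refine (Submodule.Quotient.mk_eq_zero _).2 ?_
    rw [h']
    change 1 * x * p ∈ _
    rw [one_mul]
    exact Ideal.mem_sup_right (Ideal.mul_mem_right _ _ (Ideal.mem_span_singleton_self x))

lemma colonSeq_shortExact (I' I I'' : Ideal R) (x : R) (h : ∀ p, p ∈ I' ↔ x * p ∈ I)
    (h' : I'' = I ⊔ Ideal.span {x}) : (colonSeq I' I I'' x h h').ShortExact := by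
  apply ModuleCat.shortComplex_shortExact
  · intro q
    change R ⧸ I at q
    obtain ⟨p, rfl⟩ := Submodule.Quotient.mk_surjective I q
    constructor
    · intro hp
      have hp' : 1 * p ∈ I'' := (Submodule.Quotient.mk_eq_zero _).1 hp
      rw [one_mul, h', Submodule.mem_sup] at hp'
      obtain ⟨a, ha, b, hb, rfl⟩ := hp'
      obtain ⟨c, rfl⟩ := Ideal.mem_span_singleton.1 hb
      refine ⟨(Submodule.Quotient.mk c : R ⧸ I'), ?_⟩
      refine (Submodule.Quotient.eq _).2 ?_
      have : x * c - (a + x * c) = -a := by ring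
      change x * c - (a + x * c) ∈ I
      rw [this]
      exact neg_mem ha
    · rintro ⟨q, hq⟩
      rw [← hq]
      exact congrArg (fun f => f.hom q) (colonSeq I' I I'' x h h').zero
  · refine (injective_iff_map_eq_zero (colonSeq I' I I'' x h h').f.hom).2 ?_
    intro q hq
    change R ⧸ I' at q
    obtain ⟨p, rfl⟩ := Submodule.Quotient.mk_surjective I' q
    exact (Submodule.Quotient.mk_eq_zero _).2 ((h p).2 ((Submodule.Quotient.mk_eq_zero _).1 hq))
  · intro q
    change R ⧸ I'' at q
    obtain ⟨p, rfl⟩ := Submodule.Quotient.mk_surjective I'' q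
    exact ⟨(Submodule.Quotient.mk p : R ⧸ I), congrArg _ (one_mul p)⟩

/-- The sequence `0 → R/(I ⊓ J) → R/I × R/J → R/(I ⊔ J) → 0`. -/
def infSeq (I J : Ideal R) : ShortComplex (ModuleCat.{0} R) where
  X₁ := cyc (I ⊓ J)
  X₂ := ModuleCat.of R ((R ⧸ I) × (R ⧸ J))
  X₃ := cyc (I ⊔ J)
  f := ModuleCat.ofHom
    (LinearMap.prod (Submodule.factor inf_le_left) (Submodule.factor inf_le_right))
  g := ModuleCat.ofHom (LinearMap.coprod (Submodule.factor le_sup_left)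
    (-Submodule.factor le_sup_right))
  zero := by
    refine ModuleCat.hom_ext (LinearMap.ext fun q => ?_)
    change R ⧸ (I ⊓ J) at q
    obtain ⟨p, rfl⟩ := Submodule.Quotient.mk_surjective _ q
    change Submodule.Quotient.mk p + -Submodule.Quotient.mk p = (0 : R ⧸ (I ⊔ J))
    rw [add_neg_cancel]

lemma infSeq_shortExact (I J : Ideal R) : (infSeq I J).ShortExact := by
  apply ModuleCat.shortComplex_shortExact
  · rintro ⟨q, q'⟩
    change R ⧸ I at q
    change R ⧸ J at q'
    obtain ⟨p, rfl⟩ := Submodule.Quotient.mk_surjective _ q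
    obtain ⟨p', rfl⟩ := Submodule.Quotient.mk_surjective _ q'
    constructor
    · intro hp
      have hp' : (Submodule.Quotient.mk p : R ⧸ (I ⊔ J)) + -Submodule.Quotient.mk p' = 0 := hp
      rw [← sub_eq_add_neg, sub_eq_zero, Submodule.Quotient.eq, Submodule.mem_sup] at hp'
      obtain ⟨a, ha, b, hb, hab⟩ := hp'
      refine ⟨(Submodule.Quotient.mk (p - a) : R ⧸ (I ⊓ J)), Prod.ext ?_ ?_⟩
      · refine (Submodule.Quotient.eq _).2 ?_
        change p - a - p ∈ I
        rw [sub_sub_cancel_left]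
        exact neg_mem ha
      · refine (Submodule.Quotient.eq _).2 ?_
        have : p - a - p' = b := by rw [sub_right_comm, ← hab]; ring
        change p - a - p' ∈ J
        rw [this]
        exact hb
    · rintro ⟨q, hq⟩
      rw [← hq]
      exact congrArg (fun f => f.hom q) (infSeq I J).zero
  · refine (injective_iff_map_eq_zero (infSeq I J).f.hom).2 ?_
    intro q hq
    change R ⧸ (I ⊓ J) at q
    obtain ⟨p, rfl⟩ := Submodule.Quotient.mk_surjective _ q
    exact (Submodule.Quotient.mk_eq_zero _).2 ⟨(Submodule.Quotient.mk_eq_zero _).1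
      (congrArg Prod.fst hq), (Submodule.Quotient.mk_eq_zero _).1 (congrArg Prod.snd hq)⟩
  · intro q
    change R ⧸ (I ⊔ J) at q
    obtain ⟨p, rfl⟩ := Submodule.Quotient.mk_surjective _ q
    refine ⟨((Submodule.Quotient.mk p : R ⧸ I), (0 : R ⧸ J)), ?_⟩
    change (Submodule.Quotient.mk p : R ⧸ (I ⊔ J)) +
      -(Submodule.factor (le_sup_right : J ≤ I ⊔ J) (0 : R ⧸ J)) = _
    rw [map_zero, neg_zero, add_zero]

lemma isZero_cyc_top : Limits.IsZero (cyc (⊤ : Ideal R)) := by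
  rw [ModuleCat.isZero_iff_subsingleton]
  exact Submodule.Quotient.subsingleton_iff.2 rfl

lemma pd_cyc_top (n : ℕ) : HasProjectiveDimensionLT (cyc (⊤ : Ideal R)) n :=
  have := isZero_cyc_top (R := R).hasProjectiveDimensionLT_zero
  hasProjectiveDimensionLT_of_ge _ 0 n (Nat.zero_le n)

lemma pd_cyc_bot : HasProjectiveDimensionLT (cyc (⊥ : Ideal R)) 1 :=
  have : HasProjectiveDimensionLT (ModuleCat.of R R) 1 := inferInstance
  hasProjectiveDimensionLT_of_iso
    (Submodule.quotEquivOfEqBot (⊥ : Ideal R) rfl).symm.toModuleIso 1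

lemma pd_of_colon {I' I I'' : Ideal R} {x : R} {n : ℕ} (h : ∀ p, p ∈ I' ↔ x * p ∈ I)
    (h' : I'' = I ⊔ Ideal.span {x}) (h₁ : HasProjectiveDimensionLT (cyc I') n)
    (h₃ : HasProjectiveDimensionLT (cyc I'') n) : HasProjectiveDimensionLT (cyc I) n :=
  (colonSeq_shortExact I' I I'' x h h').hasProjectiveDimensionLT_X₂ n h₁ h₃

lemma pd_prod {I J : Ideal R} {n : ℕ} (hI : HasProjectiveDimensionLT (cyc I) n)
    (hJ : HasProjectiveDimensionLT (cyc J) n) :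
    HasProjectiveDimensionLT (ModuleCat.of R ((R ⧸ I) × (R ⧸ J))) n :=
  have : HasProjectiveDimensionLT (cyc I ⊞ cyc J) n := inferInstance
  hasProjectiveDimensionLT_of_iso (ModuleCat.biprodIsoProd (cyc I) (cyc J)) n

lemma pd_inf {I J : Ideal R} {n : ℕ} (hI : HasProjectiveDimensionLT (cyc I) n)
    (hJ : HasProjectiveDimensionLT (cyc J) n)
    (hIJ : HasProjectiveDimensionLT (cyc (I ⊔ J)) (n + 1)) :
    HasProjectiveDimensionLT (cyc (I ⊓ J)) n :=
  (infSeq_shortExact I J).hasProjectiveDimensionLT_X₁ n (pd_prod hI hJ) hIJ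

lemma ext_subsingleton_of_pd {X Y : ModuleCat.{0} R} {n i : ℕ} (h : HasProjectiveDimensionLT X n)
    (hi : n ≤ i) : Subsingleton (Abelian.Ext X Y i) :=
  ⟨fun a b => by
    rw [a.eq_zero_of_hasProjectiveDimensionLT n hi, b.eq_zero_of_hasProjectiveDimensionLT n hi]⟩

end Cyclic

section Monomial

variable {V : Type} {k : Type} [Field k]

/-- An ideal containing, with each polynomial, all monomials of that polynomial. -/
def IsMon (Q : Ideal (MvPolynomial V k)) : Prop :=
  ∀ p ∈ Q, ∀ b ∈ p.support, monomial b (1 : k) ∈ Q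

lemma monomial_mem_of_one {Q : Ideal (MvPolynomial V k)} {b : V →₀ ℕ}
    (h : monomial b (1 : k) ∈ Q) (c : k) : monomial b c ∈ Q := by
  have := Q.mul_mem_left (C c) h
  rwa [C_mul_monomial, mul_one] at this

lemma mem_of_forall_monomial {Q : Ideal (MvPolynomial V k)} {p : MvPolynomial V k}
    (h : ∀ b ∈ p.support, monomial b (1 : k) ∈ Q) : p ∈ Q := by
  rw [p.as_sum]
  exact Q.sum_mem fun b hb => monomial_mem_of_one (h b hb) _

lemma IsMon.mem_iff {Q : Ideal (MvPolynomial V k)} (hQ : IsMon Q) (p : MvPolynomial V k) :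
    p ∈ Q ↔ ∀ b ∈ p.support, monomial b (1 : k) ∈ Q :=
  ⟨hQ p, mem_of_forall_monomial⟩

lemma isMon_of_iff {Q : Ideal (MvPolynomial V k)} (P : (V →₀ ℕ) → Prop)
    (h : ∀ p, p ∈ Q ↔ ∀ b ∈ p.support, P b) : IsMon Q := by
  intro p hp b hb
  rw [h]
  intro c hc
  obtain rfl : c = b := by
    have := support_monomial_subset hc
    simpa using this
  exact (h p).1 hp c hb

lemma monomial_mem_iff_of_iff {Q : Ideal (MvPolynomial V k)} {P : (V →₀ ℕ) → Prop}
    (h : ∀ p, p ∈ Q ↔ ∀ b ∈ p.support, P b) (b : V →₀ ℕ) :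
    monomial b (1 : k) ∈ Q ↔ P b := by
  classical
  rw [h, support_monomial, if_neg one_ne_zero]
  simp

lemma IsMon.inf {Q Q' : Ideal (MvPolynomial V k)} (h : IsMon Q) (h' : IsMon Q') : IsMon (Q ⊓ Q') :=
  fun p hp b hb => ⟨h p hp.1 b hb, h' p hp.2 b hb⟩

lemma IsMon.sup {Q Q' : Ideal (MvPolynomial V k)} (h : IsMon Q) (h' : IsMon Q') :
    IsMon (Q ⊔ Q') := by
  classical
  intro p hp b hb
  obtain ⟨q, hq, q', hq', rfl⟩ := Submodule.mem_sup.1 hp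
  rcases Finset.mem_union.1 (support_add hb) with hb | hb
  · exact Ideal.mem_sup_left (h q hq b hb)
  · exact Ideal.mem_sup_right (h' q' hq' b hb)

lemma IsMon.monomial_mem_sup {Q Q' : Ideal (MvPolynomial V k)} (h : IsMon Q) (h' : IsMon Q')
    {b : V →₀ ℕ} (hb : monomial b (1 : k) ∈ Q ⊔ Q') :
    monomial b (1 : k) ∈ Q ∨ monomial b (1 : k) ∈ Q' := by
  classical
  obtain ⟨q, hq, q', hq', hqq⟩ := Submodule.mem_sup.1 hb
  have hb' : b ∈ (q + q').support := by
    rw [hqq, support_monomial, if_neg one_ne_zero]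
    exact Finset.mem_singleton_self b
  rcases Finset.mem_union.1 (support_add hb') with hb | hb
  · exact Or.inl (h q hq b hb)
  · exact Or.inr (h' q' hq' b hb)

lemma mem_span_monomial_singleton (a : V →₀ ℕ) (p : MvPolynomial V k) :
    p ∈ Ideal.span {monomial a (1 : k)} ↔ ∀ b ∈ p.support, a ≤ b := by
  have := @mem_ideal_span_monomial_image V k _ p {a}
  simpa using this

lemma isMon_span_monomial (a : V →₀ ℕ) : IsMon (Ideal.span {monomial a (1 : k)}) :=
  isMon_of_iff _ (mem_span_monomial_singleton a)

lemma isMon_span_X (j : V) : IsMon (Ideal.span {(X j : MvPolynomial V k)}) :=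
  isMon_span_monomial _

/-- The colon ideal `Q : x`. -/
def colonI {R : Type} [CommRing R] (Q : Ideal R) (x : R) : Ideal R :=
  Submodule.comap (LinearMap.mulLeft R x) Q

lemma mem_colonI {R : Type} [CommRing R] {Q : Ideal R} {x p : R} : p ∈ colonI Q x ↔ x * p ∈ Q :=
  Iff.rfl

lemma le_colonI {R : Type} [CommRing R] (Q : Ideal R) (x : R) : Q ≤ colonI Q x :=
  fun _ hp => Q.mul_mem_left x hp

lemma mem_support_monomial_mul {a b : V →₀ ℕ} {p : MvPolynomial V k} :
    a + b ∈ (monomial a (1 : k) * p).support ↔ b ∈ p.support := by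
  rw [mem_support_iff, mem_support_iff, coeff_monomial_mul, one_mul]

lemma IsMon.colon_monomial {Q : Ideal (MvPolynomial V k)} (hQ : IsMon Q) (a : V →₀ ℕ) :
    IsMon (colonI Q (monomial a (1 : k))) := by
  intro p hp b hb
  rw [mem_colonI, monomial_mul, one_mul]
  exact hQ _ hp _ (mem_support_monomial_mul.2 hb)

lemma IsMon.colon_X {Q : Ideal (MvPolynomial V k)} (hQ : IsMon Q) (j : V) :
    IsMon (colonI Q (X j)) := hQ.colon_monomial _

/-- The prime ideal generated by the variables in `A`. -/
def PA (k : Type) [Field k] (A : Finset V) : Ideal (MvPolynomial V k) :=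
  Ideal.span (X '' (A : Set V))

lemma mem_PA {A : Finset V} {p : MvPolynomial V k} :
    p ∈ PA k A ↔ ∀ b ∈ p.support, ∃ i ∈ A, b i ≠ 0 := by
  rw [PA, mem_ideal_span_X_image]
  rfl

lemma isMon_PA (A : Finset V) : IsMon (PA k A) := isMon_of_iff _ fun _ => mem_PA

lemma PA_empty : PA k (∅ : Finset V) = ⊥ := by
  rw [PA, Finset.coe_empty, Set.image_empty, Ideal.span_empty]

lemma PA_univ [Fintype V] : PA k (Finset.univ : Finset V) = maxIdeal k V := by
  rw [PA, maxIdeal, Finset.coe_univ, Set.image_univ]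

lemma PA_insert [DecidableEq V] (A : Finset V) (v : V) :
    PA k (insert v A) = PA k A ⊔ Ideal.span {X v} := by
  rw [PA, PA, Finset.coe_insert, Set.image_insert_eq, Set.insert_eq, Ideal.span_union, sup_comm]

lemma X_mem_PA {A : Finset V} {i : V} : (X i : MvPolynomial V k) ∈ PA k A ↔ i ∈ A := by
  classical
  rw [mem_PA, support_X]
  simp [Finsupp.single_apply]

open Classical in
/-- Setting the variables in `A` to zero. -/
def killVars (k : Type) [Field k] (A : Finset V) : MvPolynomial V k →ₐ[k] MvPolynomial V k :=
  aeval fun i => if i ∈ A then 0 else X i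

lemma sub_killVars_mem (A : Finset V) (p : MvPolynomial V k) : p - killVars k A p ∈ PA k A := by
  induction p using MvPolynomial.induction_on with
  | C a => simp [killVars]
  | add p q hp hq =>
    rw [map_add, add_sub_add_comm]
    exact add_mem hp hq
  | mul_X p i hp =>
    have : p * X i - killVars k A (p * X i) =
        (p - killVars k A p) * X i + killVars k A p * (X i - killVars k A (X i)) := by
      rw [map_mul]
      ring
    rw [this]
    refine add_mem (Ideal.mul_mem_right _ _ hp) (Ideal.mul_mem_left _ _ ?_)
    by_cases hi : i ∈ A
    · simpa [killVars, hi] using X_mem_PA.2 hi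
    · simp [killVars, hi]

lemma mem_PA_iff_killVars {A : Finset V} {p : MvPolynomial V k} :
    p ∈ PA k A ↔ killVars k A p = 0 := by
  constructor
  · intro h
    have : PA k A ≤ RingHom.ker (killVars k A).toRingHom := by
      rw [PA, Ideal.span_le]
      rintro _ ⟨i, hi, rfl⟩
      have hi' : i ∈ A := hi
      simp [killVars, hi']
    exact this h
  · intro h
    have := sub_killVars_mem A p
    rwa [h, sub_zero] at this

lemma isPrime_PA (A : Finset V) : (PA k A).IsPrime := by
  refine ⟨fun h => ?_, fun {p q} hpq => ?_⟩
  · have : (1 : MvPolynomial V k) ∈ PA k A := h ▸ Submodule.mem_top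
    rw [mem_PA_iff_killVars, map_one] at this
    exact one_ne_zero this
  · rw [mem_PA_iff_killVars, map_mul, mul_eq_zero] at hpq
    simpa only [mem_PA_iff_killVars] using hpq

lemma X_mul_monomial_one (i : V) (b : V →₀ ℕ) :
    X i * monomial b (1 : k) = monomial (Finsupp.single i 1 + b) (1 : k) := by
  rw [X, monomial_mul, one_mul]

lemma exists_eq_single_add {b : V →₀ ℕ} {i : V} (hi : b i ≠ 0) :
    ∃ c : V →₀ ℕ, b = Finsupp.single i 1 + c :=
  exists_add_of_le (Finsupp.single_le_iff.2 (Nat.one_le_iff_ne_zero.2 hi))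

lemma one_mem_of_monomial_mem {A : Finset V} {Q : Ideal (MvPolynomial V k)}
    (h : ∀ i ∉ A, colonI Q (X i) ≤ Q) (b : V →₀ ℕ) (hb : ∀ i ∈ A, b i = 0)
    (hbQ : monomial b (1 : k) ∈ Q) : (1 : MvPolynomial V k) ∈ Q := by
  induction hd : b.degree generalizing b with
  | zero =>
    rw [Finsupp.degree_eq_zero_iff] at hd
    rwa [hd] at hbQ
  | succ d ih =>
    have hb0 : b ≠ 0 := by
      rintro rfl
      simp at hd
    obtain ⟨i, hi⟩ := Finsupp.ne_iff.1 hb0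
    obtain ⟨c, rfl⟩ := exists_eq_single_add hi
    refine ih c (fun j hj => ?_) ?_ ?_
    · have := hb j hj
      rw [Finsupp.add_apply] at this
      omega
    · refine h i (fun hiA => hi (hb i hiA)) ?_
      rwa [mem_colonI, X_mul_monomial_one]
    · rw [map_add, Finsupp.degree_single] at hd
      omega

lemma eq_top_or_eq_PA {A : Finset V} {Q : Ideal (MvPolynomial V k)} (hQ : IsMon Q)
    (h : ∀ i, X i ∈ Q ∨ colonI Q (X i) ≤ Q) (hA : ∀ i ∉ A, colonI Q (X i) ≤ Q) :
    Q = ⊤ ∨ ∃ A' ⊆ A, Q = PA k A' := by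
  classical
  by_cases h1 : (1 : MvPolynomial V k) ∈ Q
  · exact Or.inl ((Ideal.eq_top_iff_one _).2 h1)
  right
  refine ⟨A.filter fun i => X i ∈ Q, Finset.filter_subset _ _, le_antisymm ?_ ?_⟩
  · intro p hp
    rw [mem_PA]
    intro b hb
    by_contra hcon
    push Not at hcon
    refine h1 (one_mem_of_monomial_mem (A := A.filter fun i => X i ∈ Q) (fun i hi => ?_) b hcon
      (hQ p hp b hb))
    by_cases hiA : i ∈ A
    · rcases h i with h | h
      · exact absurd (Finset.mem_filter.2 ⟨hiA, h⟩) hi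
      · exact h
    · exact hA i hiA
  · rw [PA, Ideal.span_le]
    rintro _ ⟨i, hi, rfl⟩
    exact (Finset.mem_filter.1 hi).2

/-- Induction principle for monomial ideals on which the variables outside `A` are regular. -/
lemma monomial_ideal_induction [Finite V] (A : Finset V) {motive : Ideal (MvPolynomial V k) → Prop}
    (top : motive ⊤) (prime : ∀ A' ⊆ A, motive (PA k A'))
    (step : ∀ Q, ∀ j ∈ A, motive (colonI Q (X j)) → motive (Q ⊔ Ideal.span {X j}) → motive Q)
    (Q : Ideal (MvPolynomial V k)) (hQ : IsMon Q) (hA : ∀ i ∉ A, colonI Q (X i) ≤ Q) :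
    motive Q := by
  induction Q using WellFoundedGT.induction with
  | ind Q ih =>
    by_cases h : ∀ i, X i ∈ Q ∨ colonI Q (X i) ≤ Q
    · rcases eq_top_or_eq_PA hQ h hA with rfl | ⟨A', hA', rfl⟩
      · exact top
      · exact prime A' hA'
    push Not at h
    obtain ⟨j, hj, hj'⟩ := h
    have hjA : j ∈ A := by
      by_contra hjA
      exact hj' (hA j hjA)
    refine step Q j hjA (ih _ ?_ (hQ.colon_X j) ?_) (ih _ ?_ (hQ.sup (isMon_span_X j)) ?_)
    · exact lt_of_le_not_ge (le_colonI _ _) hj'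
    · intro i hi p hp
      rw [mem_colonI, mem_colonI] at hp
      rw [mem_colonI]
      refine hA i hi ?_
      rwa [mem_colonI, mul_left_comm]
    · refine lt_of_le_not_ge le_sup_left fun hle => hj (hle ?_)
      exact Ideal.mem_sup_right (Ideal.mem_span_singleton_self _)
    · intro i hi p hp
      have hm := (hQ.sup (isMon_span_X j))
      refine mem_of_forall_monomial fun b hb => ?_
      have hb' := (hm.colon_X i) p hp b hb
      rw [mem_colonI, X_mul_monomial_one] at hb'
      rcases hQ.monomial_mem_sup (isMon_span_X j) hb' with h | h
      · refine Ideal.mem_sup_left (hA i hi ?_)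
        rwa [mem_colonI, X_mul_monomial_one]
      · refine Ideal.mem_sup_right ?_
        have hij : i ≠ j := by
          rintro rfl
          exact hi hjA
        have key := monomial_mem_iff_of_iff (k := k)
          (mem_span_monomial_singleton (k := k) (Finsupp.single j 1))
        change monomial _ _ ∈ Ideal.span {monomial (Finsupp.single j 1) (1 : k)} at h
        change monomial _ _ ∈ Ideal.span {monomial (Finsupp.single j 1) (1 : k)}
        rw [key, Finsupp.single_le_iff] at h ⊢
        simpa [hij] using h

/-- The total degree of `b` in the variables from `A`. -/
def wt (A : Finset V) (b : V →₀ ℕ) : ℕ := ∑ i ∈ A, b i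

lemma wt_add (A : Finset V) (a b : V →₀ ℕ) : wt A (a + b) = wt A a + wt A b := by
  simp [wt, Finset.sum_add_distrib]

lemma wt_single [DecidableEq V] (A : Finset V) (i : V) (m : ℕ) :
    wt A (Finsupp.single i m) = if i ∈ A then m else 0 := by
  simp [wt, Finsupp.single_apply]

lemma wt_mono {A : Finset V} {a b : V →₀ ℕ} (h : a ≤ b) : wt A a ≤ wt A b :=
  Finset.sum_le_sum fun i _ => h i

lemma monomial_mem_PA_pow [Finite V] (A : Finset V) (b : V →₀ ℕ) :
    monomial b (1 : k) ∈ PA k A ^ wt A b := by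
  induction hd : b.degree generalizing b with
  | zero =>
    rw [Finsupp.degree_eq_zero_iff] at hd
    simp [hd, wt]
  | succ d ih =>
    classical
    have hb0 : b ≠ 0 := by
      rintro rfl
      simp at hd
    obtain ⟨i, hi⟩ := Finsupp.ne_iff.1 hb0
    obtain ⟨c, rfl⟩ := exists_eq_single_add hi
    rw [map_add, Finsupp.degree_single] at hd
    have hc := ih c (by omega)
    rw [← X_mul_monomial_one, wt_add, wt_single]
    split_ifs with hiA
    · rw [add_comm, pow_succ']
      exact Ideal.mul_mem_mul (X_mem_PA.2 hiA) hc
    · rw [zero_add]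
      exact Ideal.mul_mem_left _ _ hc

lemma mem_PA_pow [Finite V] (A : Finset V) (ℓ : ℕ) (p : MvPolynomial V k) :
    p ∈ PA k A ^ ℓ ↔ ∀ b ∈ p.support, ℓ ≤ wt A b := by
  classical
  constructor
  · intro hp
    induction ℓ generalizing p with
    | zero => simp
    | succ ℓ ih =>
      rw [pow_succ'] at hp
      refine Submodule.mul_induction_on hp (fun q hq r hr b hb => ?_) fun q r hq hr b hb => ?_
      · obtain ⟨c, hc, d, hd, rfl⟩ := Finset.mem_add.1 (support_mul q r hb)
        obtain ⟨i, hi, hi'⟩ := mem_PA.1 hq c hc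
        have h1 : 1 ≤ wt A c :=
          (Nat.one_le_iff_ne_zero.2 hi').trans (Finset.single_le_sum (f := fun i => c i)
            (fun _ _ => Nat.zero_le _) hi)
        have h2 := ih r hr d hd
        rw [wt_add]
        omega
      · rcases Finset.mem_union.1 (support_add hb) with hb | hb
        · exact hq b hb
        · exact hr b hb
  · intro h
    exact mem_of_forall_monomial fun b hb => Ideal.pow_le_pow_right (h b hb) (monomial_mem_PA_pow A b)

lemma isMon_PA_pow [Finite V] (A : Finset V) (ℓ : ℕ) : IsMon (PA k A ^ ℓ) :=
  isMon_of_iff _ (mem_PA_pow A ℓ)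

lemma monomial_mem_PA_pow_iff [Finite V] (A : Finset V) (ℓ : ℕ) (b : V →₀ ℕ) :
    monomial b (1 : k) ∈ PA k A ^ ℓ ↔ ℓ ≤ wt A b :=
  monomial_mem_iff_of_iff (mem_PA_pow A ℓ) b

lemma colon_PA_pow_le [Finite V] {A : Finset V} (ℓ : ℕ) {i : V} (hi : i ∉ A) :
    colonI (PA k A ^ ℓ) (X i) ≤ PA k A ^ ℓ := by
  classical
  intro p hp
  refine mem_of_forall_monomial fun b hb => ?_
  have := ((isMon_PA_pow A ℓ).colon_X i) p hp b hb
  rw [mem_colonI, X_mul_monomial_one, monomial_mem_PA_pow_iff, wt_add, wt_single, if_neg hi,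
    zero_add] at this
  rwa [monomial_mem_PA_pow_iff]

end Monomial

section SymbolicPowers

variable {V : Type} [Fintype V] [DecidableEq V] {k : Type} [Field k]

lemma PA_le_PA {A A' : Finset V} : PA k A ≤ PA k A' ↔ A ⊆ A' := by
  refine ⟨fun h i hi => X_mem_PA.1 (h (X_mem_PA.2 hi)), fun h => ?_⟩
  exact Ideal.span_mono (Set.image_mono (Finset.coe_subset.2 h))

lemma exists_isFacet {K : Set (Finset V)} {G : Finset V} (hG : G ∈ K) :
    ∃ F, IsFacet K F ∧ G ⊆ F := by
  obtain ⟨F, hGF, hF⟩ := (Set.toFinite K).exists_le_maximal hG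
  exact ⟨F, ⟨hF.1, fun G' hG' h => (hF.eq_of_le hG' h).symm⟩, hGF⟩

lemma srIdeal_le_PA {K : Set (Finset V)} (hK : IsComplex K) {F : Finset V} (hF : F ∈ K) :
    srIdeal k K ≤ PA k Fᶜ := by
  rw [srIdeal, Ideal.span_le]
  rintro _ ⟨G, hG, rfl⟩
  have : ¬ G ⊆ F := fun h => hG (hK.2 F hF G h)
  obtain ⟨i, hi, hiF⟩ := Finset.not_subset.1 this
  refine Ideal.mem_of_dvd _ (Finset.dvd_prod_of_mem _ hi) (X_mem_PA.2 (Finset.mem_compl.2 hiF))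

lemma exists_PA_le_of_srIdeal_le {K : Set (Finset V)} {q : Ideal (MvPolynomial V k)}
    (hq : q.IsPrime) (h : srIdeal k K ≤ q) : ∃ F, IsFacet K F ∧ PA k Fᶜ ≤ q := by
  classical
  set G : Finset V := Finset.univ.filter fun i => (X i : MvPolynomial V k) ∉ q with hGdef
  have hG : G ∈ K := by
    by_contra hG
    have hp : (∏ i ∈ G, X i : MvPolynomial V k) ∈ q := h (Ideal.subset_span ⟨G, hG, rfl⟩)
    obtain ⟨i, hi, hiq⟩ := (hq.prod_mem_iff).1 hp
    exact (Finset.mem_filter.1 hi).2 hiq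
  obtain ⟨F, hF, hGF⟩ := exists_isFacet hG
  refine ⟨F, hF, ?_⟩
  rw [PA, Ideal.span_le]
  rintro _ ⟨i, hi, rfl⟩
  by_contra hiq
  exact (Finset.mem_compl.1 hi) (hGF (Finset.mem_filter.2 ⟨Finset.mem_univ _, hiq⟩))

lemma mem_minimalPrimes_srIdeal {K : Set (Finset V)} (hK : IsComplex K)
    {P : Ideal (MvPolynomial V k)} :
    P ∈ (srIdeal k K).minimalPrimes ↔ ∃ F, IsFacet K F ∧ P = PA k Fᶜ := by
  constructor
  · intro hP
    obtain ⟨F, hF, hFP⟩ := exists_PA_le_of_srIdeal_le hP.1.1 hP.1.2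
    exact ⟨F, hF, le_antisymm (hP.2 ⟨isPrime_PA _, srIdeal_le_PA hK hF.1⟩ hFP) hFP⟩
  · rintro ⟨F, hF, rfl⟩
    refine ⟨⟨isPrime_PA _, srIdeal_le_PA hK hF.1⟩, fun q hq hqF => ?_⟩
    obtain ⟨G, hG, hGq⟩ := exists_PA_le_of_srIdeal_le hq.1 hq.2
    have hFG : F ⊆ G := Finset.compl_subset_compl.1 (PA_le_PA.1 (hGq.trans hqF))
    rwa [hF.2 G hG.1 hFG] at hGq

open Classical in
/-- The facets of a complex on a finite vertex set. -/
def facets (K : Set (Finset V)) : Finset (Finset V) := Finset.univ.filter (IsFacet K)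

lemma mem_facets {K : Set (Finset V)} {F : Finset V} : F ∈ facets K ↔ IsFacet K F := by
  simp [facets]

/-- The intersection of the `ℓ`-th powers of the primes attached to the sets in `𝓕`. -/
def IA (k : Type) [Field k] (𝓕 : Finset (Finset V)) (ℓ : ℕ) : Ideal (MvPolynomial V k) :=
  𝓕.inf fun F => PA k Fᶜ ^ ℓ

lemma symbPow_srIdeal {K : Set (Finset V)} (hK : IsComplex K) (ℓ : ℕ) :
    symbPow (srIdeal k K) ℓ = IA k (facets K) ℓ := by
  rw [symbPow, IA]
  apply le_antisymm
  · refine Finset.le_inf fun F hF => sInf_le ?_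
    exact ⟨_, (mem_minimalPrimes_srIdeal hK).2 ⟨F, mem_facets.1 hF, rfl⟩, rfl⟩
  · refine le_sInf ?_
    rintro _ ⟨P, hP, rfl⟩
    obtain ⟨F, hF, rfl⟩ := (mem_minimalPrimes_srIdeal hK).1 hP
    exact Finset.inf_le (f := fun F => PA k Fᶜ ^ ℓ) (mem_facets.2 hF)

lemma mem_IA' {𝓕 : Finset (Finset V)} {ℓ : ℕ} {p : MvPolynomial V k} :
    p ∈ IA k 𝓕 ℓ ↔ ∀ F ∈ 𝓕, p ∈ PA k Fᶜ ^ ℓ := by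
  rw [IA, Submodule.mem_finsetInf]

lemma mem_IA {𝓕 : Finset (Finset V)} {ℓ : ℕ} {p : MvPolynomial V k} :
    p ∈ IA k 𝓕 ℓ ↔ ∀ b ∈ p.support, ∀ F ∈ 𝓕, ℓ ≤ wt Fᶜ b := by
  simp only [mem_IA', mem_PA_pow]
  exact ⟨fun h b hb F hF => h F hF b hb, fun h F hF b hb => h b hb F hF⟩

lemma isMon_IA (𝓕 : Finset (Finset V)) (ℓ : ℕ) : IsMon (IA k 𝓕 ℓ) :=
  isMon_of_iff _ fun _ => mem_IA

lemma monomial_mem_IA {𝓕 : Finset (Finset V)} {ℓ : ℕ} {b : V →₀ ℕ} :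
    monomial b (1 : k) ∈ IA k 𝓕 ℓ ↔ ∀ F ∈ 𝓕, ℓ ≤ wt Fᶜ b :=
  monomial_mem_iff_of_iff (fun _ => mem_IA) b

lemma IA_insert (F : Finset V) (𝓕 : Finset (Finset V)) (ℓ : ℕ) :
    IA k (insert F 𝓕) ℓ = PA k Fᶜ ^ ℓ ⊓ IA k 𝓕 ℓ := by
  rw [IA, Finset.inf_insert, IA]

lemma IA_union (𝓕 𝓖 : Finset (Finset V)) (ℓ : ℕ) :
    IA k (𝓕 ∪ 𝓖) ℓ = IA k 𝓕 ℓ ⊓ IA k 𝓖 ℓ := by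
  rw [IA, Finset.inf_union, IA, IA]

lemma IA_anti {𝓕 𝓖 : Finset (Finset V)} (h : 𝓖 ⊆ 𝓕) (ℓ : ℕ) : IA k 𝓕 ℓ ≤ IA k 𝓖 ℓ :=
  Finset.inf_mono h

lemma colon_IA_le {𝓕 : Finset (Finset V)} (ℓ : ℕ) {i : V} (hi : ∀ F ∈ 𝓕, i ∈ F) :
    colonI (IA k 𝓕 ℓ) (X i) ≤ IA k 𝓕 ℓ := by
  intro p hp
  rw [mem_colonI, mem_IA'] at hp
  refine mem_IA'.2 fun F hF => ?_
  exact colon_PA_pow_le ℓ (by simpa using hi F hF) (hp F hF)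

/-! ### Projective dimension bounds -/

lemma pd_cyc_PA (A : Finset V) : HasProjectiveDimensionLT (cyc (PA k A)) (A.card + 1) := by
  induction A using Finset.induction_on with
  | empty =>
    rw [PA_empty]
    exact pd_cyc_bot
  | insert v A hv ih =>
    rw [Finset.card_insert_of_notMem hv]
    have hS := colonSeq_shortExact (PA k A) (PA k A) (PA k (insert v A)) (X v)
      (fun p => ⟨fun hp => Ideal.mul_mem_left _ _ hp, fun hp =>
        ((isPrime_PA A).mem_or_mem hp).resolve_left (fun h => hv (X_mem_PA.1 h))⟩)
      (PA_insert A v)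
    have h2 : HasProjectiveDimensionLT (cyc (PA k A)) (A.card + 1 + 1) :=
      hasProjectiveDimensionLT_of_ge _ (A.card + 1) _ (by lia)
    exact hS.hasProjectiveDimensionLT_X₃ _ ih h2

lemma pd_cyc_of_isMon (A : Finset V) {Q : Ideal (MvPolynomial V k)} (hQ : IsMon Q)
    (hA : ∀ i ∉ A, colonI Q (X i) ≤ Q) : HasProjectiveDimensionLT (cyc Q) (A.card + 1) := by
  refine monomial_ideal_induction A
    (motive := fun Q => HasProjectiveDimensionLT (cyc Q) (A.card + 1)) ?_ ?_ ?_ Q hQ hA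
  · exact pd_cyc_top _
  · intro A' hA'
    have := pd_cyc_PA (k := k) A'
    exact hasProjectiveDimensionLT_of_ge _ (A'.card + 1) _
      (by have := Finset.card_le_card hA'; lia)
  · intro Q j _ h1 h3
    exact pd_of_colon (fun p => mem_colonI) rfl h1 h3

end SymbolicPowers

section Generators

variable {V : Type} [Fintype V] [DecidableEq V] {k : Type} [Field k]

lemma colon_sup_le {Q Q' : Ideal (MvPolynomial V k)} (hQ : IsMon Q) (hQ' : IsMon Q') {i : V}
    (h : colonI Q (X i) ≤ Q) (h' : colonI Q' (X i) ≤ Q') :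
    colonI (Q ⊔ Q') (X i) ≤ Q ⊔ Q' := by
  intro p hp
  refine mem_of_forall_monomial fun b hb => ?_
  have := ((hQ.sup hQ').colon_X i) p hp b hb
  rw [mem_colonI, X_mul_monomial_one] at this
  rcases hQ.monomial_mem_sup hQ' this with h1 | h1 <;> rw [← X_mul_monomial_one] at h1
  · exact Ideal.mem_sup_left (h h1)
  · exact Ideal.mem_sup_right (h' h1)

lemma pd_cyc_IA (B : Finset V) (m : ℕ) (hB : B.card ≤ m + 1) (ℓ : ℕ) (𝓕 : Finset (Finset V))
    (h : ∀ F ∈ 𝓕, Fᶜ ⊆ B ∧ Fᶜ.card ≤ m) :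
    HasProjectiveDimensionLT (cyc (IA k 𝓕 ℓ)) (m + 1) := by
  induction 𝓕 using Finset.induction_on with
  | empty => exact pd_cyc_top _
  | insert F 𝓕 hF ih =>
    have h𝓕 : ∀ G ∈ 𝓕, Gᶜ ⊆ B ∧ Gᶜ.card ≤ m := fun G hG => h G (Finset.mem_insert_of_mem hG)
    have hF := h F (Finset.mem_insert_self F 𝓕)
    rw [IA_insert]
    have h1 := pd_cyc_of_isMon Fᶜ (isMon_PA_pow (k := k) Fᶜ ℓ)
      fun i hi => colon_PA_pow_le ℓ hi
    have h2 := pd_cyc_of_isMon B ((isMon_PA_pow (k := k) Fᶜ ℓ).sup (isMon_IA 𝓕 ℓ))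
      fun i hi => colon_sup_le (isMon_PA_pow _ _) (isMon_IA _ _)
        (colon_PA_pow_le ℓ fun h' => hi (hF.1 h'))
        (colon_IA_le ℓ fun G hG => by
          by_contra h'
          exact hi ((h𝓕 G hG).1 (Finset.mem_compl.2 h')))
    exact pd_inf (hasProjectiveDimensionLT_of_ge _ (Fᶜ.card + 1) _ (by lia)) (ih h𝓕)
      (hasProjectiveDimensionLT_of_ge _ (B.card + 1) _ (by lia))

lemma mem_of_mul_mem_of_isMon (A : Finset V) {s : MvPolynomial V k}
    (hs : ∀ A' ⊆ A, s ∉ PA k A') {Q : Ideal (MvPolynomial V k)} (hQ : IsMon Q)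
    (hA : ∀ i ∉ A, colonI Q (X i) ≤ Q) : ∀ p, s * p ∈ Q → p ∈ Q := by
  refine monomial_ideal_induction A (motive := fun Q => ∀ p, s * p ∈ Q → p ∈ Q) ?_ ?_ ?_ Q hQ hA
  · exact fun _ _ => Submodule.mem_top
  · exact fun A' hA' p hp => ((isPrime_PA A').mem_or_mem hp).resolve_left (hs A' hA')
  · intro Q j _ h1 h3 p hp
    obtain ⟨q, hq, r, hr, rfl⟩ := Submodule.mem_sup.1 (h3 p (Ideal.mem_sup_left hp))
    obtain ⟨r, rfl⟩ := Ideal.mem_span_singleton'.1 hr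
    refine add_mem hq ?_
    rw [mul_comm]
    refine h1 r ?_
    rw [mem_colonI]
    have := sub_mem hp (Q.mul_mem_left s hq)
    convert this using 1
    ring

/-- The sum of all variables. -/
def sumX (V k : Type) [Fintype V] [Field k] : MvPolynomial V k := ∑ i, X i

lemma sumX_notMem_PA {A : Finset V} (hA : A ≠ Finset.univ) : sumX V k ∉ PA k A := by
  intro h
  obtain ⟨i, hi⟩ : ∃ i, i ∉ A := by
    by_contra! h'
    exact hA (Finset.eq_univ_iff_forall.2 h')
  have hc : coeff (Finsupp.single i 1) (sumX V k) = 1 := by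
    rw [sumX, coeff_sum, Finset.sum_eq_single i]
    · simp
    · intro j _ hj
      rw [coeff_X, if_neg]
      exact fun h => hj ((Finsupp.single_left_injective one_ne_zero) h)
    · exact fun h => absurd (Finset.mem_univ i) h
  obtain ⟨j, hj, hj'⟩ := mem_PA.1 h (Finsupp.single i 1) (by
    rw [mem_support_iff, hc]
    exact one_ne_zero)
  have : i = j := by
    by_contra hij
    exact hj' (Finsupp.single_eq_of_ne (Ne.symm hij))
  exact hi (this ▸ hj)

lemma mem_IA_of_sumX_mul_mem {𝓕 : Finset (Finset V)} (h𝓕 : ∀ F ∈ 𝓕, F.Nonempty) (ℓ : ℕ)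
    (p : MvPolynomial V k) (hp : sumX V k * p ∈ IA k 𝓕 ℓ) : p ∈ IA k 𝓕 ℓ := by
  rw [mem_IA'] at hp ⊢
  intro F hF
  refine mem_of_mul_mem_of_isMon Fᶜ (fun A' hA' => sumX_notMem_PA ?_) (isMon_PA_pow _ _)
    (fun i hi => colon_PA_pow_le ℓ hi) p (hp F hF)
  rintro rfl
  obtain ⟨i, hi⟩ := h𝓕 F hF
  exact Finset.mem_compl.1 (hA' (Finset.mem_univ i)) hi

/-- The polynomial ring as a module over itself. -/
abbrev polyMod (V k : Type) [Field k] : ModuleCat.{0} (MvPolynomial V k) :=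
  ModuleCat.of _ (MvPolynomial V k)

lemma exists_generator_ext_bot :
    ∃ e : Abelian.Ext (cyc (⊥ : Ideal (MvPolynomial V k))) (polyMod V k) 0,
      (∀ x, ∃ g : MvPolynomial V k, x = g • e) ∧ ∀ g : MvPolynomial V k, g • e = 0 → g = 0 := by
  let φ : cyc (⊥ : Ideal (MvPolynomial V k)) ⟶ polyMod V k :=
    ModuleCat.ofHom (Submodule.quotEquivOfEqBot (⊥ : Ideal (MvPolynomial V k)) rfl).toLinearMap
  have hφ (p : MvPolynomial V k) :
      φ.hom (Submodule.Quotient.mk p : MvPolynomial V k ⧸ (⊥ : Ideal _)) = p := rfl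
  refine ⟨Abelian.Ext.mk₀ φ, fun x => ?_, fun g hg => ?_⟩
  · obtain ⟨f, rfl⟩ := (Abelian.Ext.mk₀_bijective _ _).2 x
    refine ⟨f.hom (Submodule.Quotient.mk 1 : MvPolynomial V k ⧸ (⊥ : Ideal _)), ?_⟩
    rw [← Abelian.Ext.mk₀_smul]
    congr 1
    refine ModuleCat.hom_ext (LinearMap.ext fun q => ?_)
    change MvPolynomial V k ⧸ (⊥ : Ideal _) at q
    obtain ⟨p, rfl⟩ := Submodule.Quotient.mk_surjective _ q
    have h1 : (Submodule.Quotient.mk p : MvPolynomial V k ⧸ (⊥ : Ideal _)) =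
        p • Submodule.Quotient.mk 1 := by
      rw [← Submodule.Quotient.mk_smul, smul_eq_mul, mul_one]
    have h2 := f.hom.map_smul p (Submodule.Quotient.mk 1 : MvPolynomial V k ⧸ (⊥ : Ideal _))
    rw [← h1] at h2
    refine h2.trans ?_
    exact mul_comm _ _
  · rw [← Abelian.Ext.mk₀_smul] at hg
    have h0 := (Abelian.Ext.mk₀_bijective _ _).1 (hg.trans (Abelian.Ext.mk₀_zero _ _).symm)
    have h1 := congrArg
      (fun f => f.hom (Submodule.Quotient.mk 1 : MvPolynomial V k ⧸ (⊥ : Ideal _))) h0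
    have h2 : g • (1 : MvPolynomial V k) = 0 := h1
    rwa [smul_eq_mul, mul_one] at h2

lemma exists_generator_ext_PA (A : Finset V) :
    ∃ e : Abelian.Ext (cyc (PA k A)) (polyMod V k) A.card,
      (∀ x, ∃ g : MvPolynomial V k, x = g • e) ∧
      ∀ g : MvPolynomial V k, g • e = 0 ↔ g ∈ PA k A := by
  induction A using Finset.induction_on with
  | empty =>
    obtain ⟨e, h1, h2⟩ := exists_generator_ext_bot (V := V) (k := k)
    rw [PA_empty]
    refine ⟨e, h1, fun g => ⟨h2 g, ?_⟩⟩
    intro hg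
    rw [(Submodule.mem_bot _).1 hg]
    exact zero_smul _ _
  | insert v A hv ih =>
    obtain ⟨e, he, he'⟩ := ih
    rw [Finset.card_insert_of_notMem hv]
    have hS := colonSeq_shortExact (PA k A) (PA k A) (PA k (insert v A)) (X v)
      (fun p => ⟨fun hp => Ideal.mul_mem_left _ _ hp, fun hp =>
        ((isPrime_PA A).mem_or_mem hp).resolve_left (fun h => hv (X_mem_PA.1 h))⟩)
      (PA_insert A v)
    have hsub := ext_subsingleton_of_pd (Y := polyMod V k) (pd_cyc_PA (k := k) A) le_rfl
    let δ (y : Abelian.Ext (cyc (PA k A)) (polyMod V k) A.card) :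
        Abelian.Ext (cyc (PA k (insert v A))) (polyMod V k) (A.card + 1) :=
      hS.extClass.comp y (add_comm 1 A.card)
    have hδ (g : MvPolynomial V k) (y) : δ (g • y) = g • δ y :=
      Abelian.Ext.comp_smul _ _ _ _
    refine ⟨δ e, fun x => ?_, fun g => ⟨fun hg => ?_, fun hg => ?_⟩⟩
    · obtain ⟨y, hy⟩ := Abelian.Ext.contravariant_sequence_exact₃ hS (polyMod V k) x
        (hsub.elim _ _) (add_comm 1 A.card)
      obtain ⟨g, rfl⟩ := he y
      exact ⟨g, hy.symm.trans (hδ g e)⟩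
    · rw [← hδ] at hg
      obtain ⟨y, hy⟩ := Abelian.Ext.contravariant_sequence_exact₁ hS (polyMod V k) (g • e)
        (add_comm 1 A.card) hg
      obtain ⟨h, rfl⟩ := he y
      have h1 : X v • h • e = g • e :=
        (mulMap_precomp (PA k A) (X v) (fun p hp => Ideal.mul_mem_left _ _ hp) (h • e)).symm.trans hy
      have h2 : (g - X v * h) • e = 0 := by
        rw [sub_smul, mul_smul, h1, sub_self]
      rw [PA_insert]
      have := add_mem (Ideal.mem_sup_left (T := Ideal.span {X v}) ((he' _).1 h2))
        (Ideal.mem_sup_right (S := PA k A) (Ideal.mul_mem_right h _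
          (Ideal.mem_span_singleton_self (X v))))
      rwa [sub_add_cancel] at this
    · rw [PA_insert] at hg
      obtain ⟨p, hp, r, hr, rfl⟩ := Submodule.mem_sup.1 hg
      obtain ⟨h, rfl⟩ := Ideal.mem_span_singleton'.1 hr
      have h1 : δ ((X v : MvPolynomial V k) • e) = 0 := by
        have h2 : (Abelian.Ext.mk₀ (mulMap (PA k A) (PA k A) (X v)
            fun p hp => Ideal.mul_mem_left _ _ hp)).comp e (zero_add _) =
            (X v : MvPolynomial V k) • e :=
          mulMap_precomp _ _ _ e
        rw [← h2]
        exact hS.extClass_comp_assoc _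
      rw [add_smul, mul_smul, ← hδ, ← hδ, ← hδ, (he' p).2 hp, hδ h, h1, smul_zero, add_zero]
      exact Abelian.Ext.comp_zero _ _ _ _ _

lemma nontrivial_ext_PA (A : Finset V) :
    Nontrivial (Abelian.Ext (cyc (PA k A)) (polyMod V k) A.card) := by
  obtain ⟨e, -, he⟩ := exists_generator_ext_PA (k := k) A
  refine ⟨⟨e, 0, fun h => (isPrime_PA (k := k) A).ne_top ((Ideal.eq_top_iff_one _).2 ?_)⟩⟩
  rw [← he, h, smul_zero]

end Generators

section Socle

variable {V : Type} [Fintype V] [DecidableEq V] {k : Type} [Field k]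

lemma exists_monomial_mul_mem_socle {Q : Ideal (MvPolynomial V k)} {u : MvPolynomial V k}
    (hu : u ∉ Q) (N : ℕ) (h : ∀ i, X i ^ N * u ∈ Q) :
    ∃ b : V →₀ ℕ, monomial b (1 : k) * u ∉ Q ∧ ∀ i, X i * (monomial b (1 : k) * u) ∈ Q := by
  have hfin : {b : V →₀ ℕ | monomial b (1 : k) * u ∉ Q}.Finite := by
    refine (Set.finite_Iic (Finsupp.equivFunOnFinite.symm fun _ => N)).subset fun b hb i => ?_
    by_contra hlt
    change ¬ b i ≤ N at hlt
    refine hb ?_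
    obtain ⟨c, rfl⟩ := exists_add_of_le (Finsupp.single_le_iff.2 (not_le.1 hlt).le)
    rw [add_comm, ← one_mul (1 : k), ← monomial_mul, mul_assoc, ← X_pow_eq_monomial]
    exact Q.mul_mem_left _ (h i)
  obtain ⟨b, hb⟩ := hfin.exists_maximal ⟨0, by
    change monomial 0 (1 : k) * u ∉ Q
    rwa [monomial_zero', C_1, one_mul]⟩
  refine ⟨b, hb.1, fun i => ?_⟩
  by_contra hne
  rw [← mul_assoc, X_mul_monomial_one] at hne
  have h1 := hb.2 hne le_add_self i
  rw [Finsupp.add_apply, Finsupp.single_eq_same] at h1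
  lia

lemma mem_maxIdeal_iff {p : MvPolynomial V k} : p ∈ maxIdeal k V ↔ constantCoeff p = 0 := by
  rw [← PA_univ, mem_PA, constantCoeff_eq]
  constructor
  · intro h
    by_contra h0
    obtain ⟨i, -, hi⟩ := h 0 (mem_support_iff.2 h0)
    exact hi rfl
  · intro h b hb
    by_contra! h'
    have : b = 0 := Finsupp.ext fun i => h' i (Finset.mem_univ i)
    exact (mem_support_iff.1 hb) (this ▸ h)

lemma X_mem_maxIdeal (i : V) : (X i : MvPolynomial V k) ∈ maxIdeal k V :=
  Ideal.subset_span ⟨i, rfl⟩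

lemma maxIdeal_le {J : Ideal (MvPolynomial V k)} (h : ∀ i, X i ∈ J) : maxIdeal k V ≤ J := by
  rw [maxIdeal, Ideal.span_le]
  rintro _ ⟨i, rfl⟩
  exact h i

lemma mem_maxIdeal_iff_mul_mem {Q : Ideal (MvPolynomial V k)} {u : MvPolynomial V k} (hu : u ∉ Q)
    (h : ∀ i, X i * u ∈ Q) (p : MvPolynomial V k) : p ∈ maxIdeal k V ↔ u * p ∈ Q := by
  have hle : maxIdeal k V ≤ colonI Q u := maxIdeal_le fun i => by
    rw [mem_colonI, mul_comm]
    exact h i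
  refine ⟨fun hp => hle hp, fun hp => ?_⟩
  rw [mem_maxIdeal_iff]
  by_contra hc
  have h1 : p - C (constantCoeff p) ∈ maxIdeal k V := by
    rw [mem_maxIdeal_iff, map_sub, constantCoeff_C, sub_self]
  have h2 := sub_mem hp (hle h1)
  change u * p - u * (p - C (constantCoeff p)) ∈ Q at h2
  rw [← mul_sub, sub_sub_cancel] at h2
  have h3 := Q.mul_mem_right (C (constantCoeff p)⁻¹) h2
  rw [mul_assoc, ← C_mul, mul_inv_cancel₀ hc, C_1, mul_one] at h3
  exact hu h3

lemma pd_cyc_maxIdeal : HasProjectiveDimensionLT (cyc (maxIdeal k V)) (Fintype.card V + 1) := by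
  have := pd_cyc_PA (k := k) (Finset.univ : Finset V)
  rwa [PA_univ] at this

lemma pd_cyc_of_pow_mem (N : ℕ) (Q : Ideal (MvPolynomial V k)) (hQ : ∀ i, X i ^ N ∈ Q) :
    HasProjectiveDimensionLT (cyc Q) (Fintype.card V + 1) := by
  induction Q using WellFoundedGT.induction with
  | ind Q ih =>
    by_cases htop : Q = ⊤
    · rw [htop]
      exact pd_cyc_top _
    obtain ⟨b, hu, hu'⟩ := exists_monomial_mul_mem_socle
      (fun h => htop ((Ideal.eq_top_iff_one Q).2 h)) N fun i => by
        rw [mul_one]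
        exact hQ i
    rw [mul_one] at hu hu'
    have hlt : Q < Q ⊔ Ideal.span {monomial b (1 : k)} := by
      refine lt_of_le_of_ne le_sup_left fun h => hu ?_
      rw [h]
      exact Ideal.mem_sup_right (Ideal.mem_span_singleton_self _)
    exact pd_of_colon (mem_maxIdeal_iff_mul_mem hu hu') rfl pd_cyc_maxIdeal
      (ih _ hlt fun i => hlt.le (hQ i))

/-! ### Low degree Ext from the residue field -/

lemma ext_zero_subsingleton {M : ModuleCat.{0} (MvPolynomial V k)}
    (h : ∀ u : M, (∀ i, (X i : MvPolynomial V k) • u = 0) → u = 0) :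
    Subsingleton (Abelian.Ext (cyc (maxIdeal k V)) M 0) := by
  have key : ∀ f : cyc (maxIdeal k V) ⟶ M, f = 0 := by
    intro f
    have h0 : f.hom (Submodule.Quotient.mk 1 : MvPolynomial V k ⧸ maxIdeal k V) = 0 := by
      refine h _ fun i => ?_
      rw [← map_smul]
      have : (X i : MvPolynomial V k) •
          (Submodule.Quotient.mk 1 : MvPolynomial V k ⧸ maxIdeal k V) = 0 := by
        rw [← Submodule.Quotient.mk_smul, Submodule.Quotient.mk_eq_zero, smul_eq_mul, mul_one]
        exact X_mem_maxIdeal i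
      exact (congrArg f.hom this).trans (map_zero _)
    refine ModuleCat.hom_ext (LinearMap.ext fun q => ?_)
    change MvPolynomial V k ⧸ maxIdeal k V at q
    obtain ⟨p, rfl⟩ := Submodule.Quotient.mk_surjective _ q
    have h1 : (Submodule.Quotient.mk p : MvPolynomial V k ⧸ maxIdeal k V) =
        p • Submodule.Quotient.mk 1 := by
      rw [← Submodule.Quotient.mk_smul, smul_eq_mul, mul_one]
    have h2 := f.hom.map_smul p (Submodule.Quotient.mk 1 : MvPolynomial V k ⧸ maxIdeal k V)
    rw [← h1, h0, smul_zero] at h2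
    exact h2
  constructor
  intro a b
  obtain ⟨f, rfl⟩ := (Abelian.Ext.mk₀_bijective _ _).2 a
  obtain ⟨g, rfl⟩ := (Abelian.Ext.mk₀_bijective _ _).2 b
  rw [key f, key g]

lemma ext_zero_nontrivial {Q : Ideal (MvPolynomial V k)} {u : MvPolynomial V k} (hu : u ∉ Q)
    (h : ∀ i, X i * u ∈ Q) : Nontrivial (Abelian.Ext (cyc (maxIdeal k V)) (cyc Q) 0) := by
  refine ⟨⟨Abelian.Ext.mk₀ (mulMap (maxIdeal k V) Q u
    fun p hp => (mem_maxIdeal_iff_mul_mem hu h p).1 hp), 0, fun h0 => hu ?_⟩⟩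
  have h1 := (Abelian.Ext.mk₀_bijective _ _).1 (h0.trans (Abelian.Ext.mk₀_zero _ _).symm)
  have h2 : (Submodule.Quotient.mk (u * 1) : MvPolynomial V k ⧸ Q) = 0 := congrArg
    (fun f => f.hom (Submodule.Quotient.mk 1 : MvPolynomial V k ⧸ maxIdeal k V)) h1
  rwa [Submodule.Quotient.mk_eq_zero, mul_one] at h2

lemma smul_ext_eq_zero {R : Type} [CommRing R] {I : Ideal R} {x : R} (hx : x ∈ I)
    {Y : ModuleCat.{0} R} {n : ℕ} (e : Abelian.Ext (cyc I) Y n) : x • e = 0 := by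
  rw [← mulMap_precomp I x (fun p hp => I.mul_mem_left x hp) e]
  have : mulMap I I x (fun p hp => I.mul_mem_left x hp) = 0 := by
    refine ModuleCat.hom_ext (LinearMap.ext fun q => ?_)
    change R ⧸ I at q
    obtain ⟨p, rfl⟩ := Submodule.Quotient.mk_surjective I q
    exact (Submodule.Quotient.mk_eq_zero _).2 (I.mul_mem_right p hx)
  rw [this, Abelian.Ext.mk₀_zero, Abelian.Ext.zero_comp]

lemma mulMap_postcomp {R : Type} [CommRing R] (I : Ideal R) (x : R) (h : ∀ p ∈ I, x * p ∈ I)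
    {Y : ModuleCat.{0} R} {n : ℕ} (e : Abelian.Ext Y (cyc I) n) :
    e.comp (Abelian.Ext.mk₀ (mulMap I I x h)) (add_zero n) = x • e := by
  rw [mulMap_self, Abelian.Ext.mk₀_smul, Abelian.Ext.comp_smul, Abelian.Ext.comp_mk₀_id]

lemma ext_succ_subsingleton_of_regular {R : Type} [CommRing R] {m I : Ideal R} {x : R}
    (hx : x ∈ m) (hreg : ∀ p, x * p ∈ I → p ∈ I) {i : ℕ}
    (h : Subsingleton (Abelian.Ext (cyc m) (cyc (I ⊔ Ideal.span {x})) i)) :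
    Subsingleton (Abelian.Ext (cyc m) (cyc I) (i + 1)) := by
  have hS := colonSeq_shortExact I I _ x (fun p => ⟨fun hp => I.mul_mem_left x hp, hreg p⟩) rfl
  have key (e : Abelian.Ext (cyc m) (cyc I) (i + 1)) : e = 0 := by
    have h0 : e.comp (Abelian.Ext.mk₀ (mulMap I I x fun p hp => I.mul_mem_left x hp))
        (add_zero (i + 1)) = 0 := by
      rw [mulMap_postcomp, smul_ext_eq_zero hx]
    obtain ⟨y, hy⟩ := Abelian.Ext.covariant_sequence_exact₁ (cyc m) hS e h0 rfl
    rw [← hy, h.elim y 0]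
    exact Abelian.Ext.zero_comp _ _ hS.extClass _ _
  exact ⟨fun a b => (key a).trans (key b).symm⟩

lemma ext_succ_nontrivial_of_regular {R : Type} [CommRing R] {m I : Ideal R} {x : R}
    (hreg : ∀ p, x * p ∈ I → p ∈ I) {i : ℕ}
    (h₁ : Subsingleton (Abelian.Ext (cyc m) (cyc I) i))
    (h₂ : Nontrivial (Abelian.Ext (cyc m) (cyc (I ⊔ Ideal.span {x})) i)) :
    Nontrivial (Abelian.Ext (cyc m) (cyc I) (i + 1)) :=
  ext_nontrivial_X₁
    (colonSeq_shortExact I I _ x (fun p => ⟨fun hp => I.mul_mem_left x hp, hreg p⟩) rfl)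
    (cyc m) h₁ h₂

/-! ### Annihilation and vanishing of Ext into the polynomial ring -/

lemma ext_subsingleton_of_pow_smul {R : Type} [CommRing R] {I : Ideal R} {x : R}
    (hreg : ∀ p, x * p ∈ I → p ∈ I) {Y : ModuleCat.{0} R} {i N : ℕ}
    (h : Subsingleton (Abelian.Ext (cyc (I ⊔ Ideal.span {x})) Y (i + 1)))
    (hN : ∀ e : Abelian.Ext (cyc I) Y i, x ^ N • e = 0) :
    Subsingleton (Abelian.Ext (cyc I) Y i) := by
  have hS := colonSeq_shortExact I I _ x (fun p => ⟨fun hp => I.mul_mem_left x hp, hreg p⟩) rfl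
  have hsurj (e : Abelian.Ext (cyc I) Y i) : ∃ e' : Abelian.Ext (cyc I) Y i, x • e' = e := by
    obtain ⟨y, hy⟩ := ext_contra_precomp_surjective hS Y h e
    exact ⟨y, (mulMap_precomp I x (fun p hp => I.mul_mem_left x hp) y).symm.trans hy⟩
  have hpow (j : ℕ) (e : Abelian.Ext (cyc I) Y i) :
      ∃ e' : Abelian.Ext (cyc I) Y i, x ^ j • e' = e := by
    induction j with
    | zero => exact ⟨e, by rw [pow_zero, one_smul]⟩
    | succ j ih =>
      obtain ⟨e', rfl⟩ := ih
      obtain ⟨e'', rfl⟩ := hsurj e'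
      exact ⟨e'', by rw [pow_succ, mul_smul]⟩
  have key (e : Abelian.Ext (cyc I) Y i) : e = 0 := by
    obtain ⟨e', rfl⟩ := hpow N e
    exact hN e'
  exact ⟨fun a b => (key a).trans (key b).symm⟩

lemma exists_pow_smul_eq_zero {M : Type} [AddCommGroup M] [Module (MvPolynomial V k) M] {N : ℕ}
    (h : ∀ i, ∀ u : M, (X i : MvPolynomial V k) ^ N • u = 0) {p : MvPolynomial V k}
    (hp : p ∈ maxIdeal k V) : ∃ N', ∀ u : M, p ^ N' • u = 0 := by
  have hle : maxIdeal k V ≤ (Module.annihilator (MvPolynomial V k) M).radical :=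
    maxIdeal_le fun i => ⟨N, Module.mem_annihilator.2 (h i)⟩
  obtain ⟨N', hN'⟩ := hle hp
  exact ⟨N', Module.mem_annihilator.1 hN'⟩

lemma ext_card_nontrivial {Q : Ideal (MvPolynomial V k)} (hQ : IsMon Q) {b : V →₀ ℕ}
    (hb : monomial b (1 : k) ∉ Q) (h : ∀ i, X i * monomial b (1 : k) ∈ Q) :
    Nontrivial (Abelian.Ext (cyc Q) (polyMod V k) (Fintype.card V)) := by
  have hS := colonSeq_shortExact (maxIdeal k V) Q _ (monomial b (1 : k))
    (mem_maxIdeal_iff_mul_mem hb h) rfl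
  have h1 := nontrivial_ext_PA (k := k) (Finset.univ : Finset V)
  rw [PA_univ] at h1
  have h3 := pd_cyc_of_isMon Finset.univ (hQ.sup (isMon_span_monomial b))
    fun i hi => absurd (Finset.mem_univ i) hi
  exact ext_contra_nontrivial_X₂ hS (polyMod V k) h1 (ext_subsingleton_of_pd h3 le_rfl)

/-! ### Dimension, depth and Serre depth criteria -/

lemma zero_le_modDim_iff {R : Type} [CommRing R] (M : ModuleCat.{0} R) :
    0 ≤ modDim M ↔ Nontrivial M := by
  constructor
  · intro h
    by_contra hM
    rw [not_nontrivial_iff_subsingleton] at hM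
    have : Module.annihilator R M = ⊤ := Module.annihilator_eq_top_iff.2 hM
    rw [modDim, this] at h
    have hs : Subsingleton (R ⧸ (⊤ : Ideal R)) := Ideal.Quotient.subsingleton_iff.2 rfl
    rw [ringKrullDim_eq_bot_of_subsingleton] at h
    exact absurd h (by simp)
  · intro hM
    have : Nontrivial (R ⧸ Module.annihilator R M) := by
      rw [Ideal.Quotient.nontrivial_iff]
      intro h
      exact not_subsingleton M (Module.annihilator_eq_top_iff.1 h)
    exact ringKrullDim_nonneg_of_nontrivial

lemma one_le_modDim {R : Type} [CommRing R] (M : ModuleCat.{0} R) {p q : Ideal R} (hp : p.IsPrime)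
    (hq : q.IsPrime) (hpq : p < q) (h : Module.annihilator R M ≤ p) : 1 ≤ modDim M := by
  rw [modDim, ringKrullDim_quotient, Order.one_le_krullDim_iff]
  exact ⟨⟨⟨p, hp⟩, h⟩, ⟨⟨q, hq⟩, h.trans hpq.le⟩, hpq⟩

lemma mdepth_eq_one {M : ModuleCat.{0} (MvPolynomial V k)}
    (h0 : Subsingleton (Abelian.Ext (cyc (maxIdeal k V)) M 0))
    (h1 : Nontrivial (Abelian.Ext (cyc (maxIdeal k V)) M 1)) : mdepth k M = 1 := by
  refine IsLeast.csInf_eq ⟨(nontrivial_extM_iff 1).2 h1, fun i hi => ?_⟩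
  by_contra hlt
  obtain rfl : i = 0 := by lia
  exact not_nontrivial_iff_subsingleton.2 h0 ((nontrivial_extM_iff 0).1 hi)

lemma mdepth_eq_two {M : ModuleCat.{0} (MvPolynomial V k)}
    (h0 : Subsingleton (Abelian.Ext (cyc (maxIdeal k V)) M 0))
    (h1 : Subsingleton (Abelian.Ext (cyc (maxIdeal k V)) M 1))
    (h2 : Nontrivial (Abelian.Ext (cyc (maxIdeal k V)) M 2)) : mdepth k M = 2 := by
  refine IsLeast.csInf_eq ⟨(nontrivial_extM_iff 2).2 h2, fun i hi => ?_⟩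
  by_contra hlt
  have hi' := (nontrivial_extM_iff i).1 hi
  obtain rfl | rfl : i = 0 ∨ i = 1 := by lia
  · exact not_nontrivial_iff_subsingleton.2 h0 hi'
  · exact not_nontrivial_iff_subsingleton.2 h1 hi'

lemma serreDepth_two_eq_one {M : ModuleCat.{0} (MvPolynomial V k)}
    (h0 : Subsingleton (Abelian.Ext M (polyMod V k) (Fintype.card V)))
    (h1 : Nontrivial (Abelian.Ext M (polyMod V k) (Fintype.card V - 1))) :
    serreDepth k 2 M = 1 := by
  rw [← Nat.card_eq_fintype_card] at h0 h1
  refine IsLeast.csInf_eq ⟨?_, fun i hi => ?_⟩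
  · exact (zero_le_modDim_iff _).2 ((nontrivial_extM_iff _).2 h1)
  · by_contra hlt
    obtain rfl : i = 0 := by lia
    have h2 := (nontrivial_extM_iff _).1 ((zero_le_modDim_iff _).1 hi)
    exact not_nontrivial_iff_subsingleton.2 h0 h2

lemma serreDepth_two_eq_two {M : ModuleCat.{0} (MvPolynomial V k)}
    (h0 : Subsingleton (Abelian.Ext M (polyMod V k) (Fintype.card V)))
    (h1 : Subsingleton (Abelian.Ext M (polyMod V k) (Fintype.card V - 1)))
    {A : Finset V} (hA : A ≠ Finset.univ)
    (h2 : Module.annihilator (MvPolynomial V k)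
      (Abelian.Ext M (polyMod V k) (Fintype.card V - 2)) ≤ PA k A) :
    serreDepth k 2 M = 2 := by
  rw [← Nat.card_eq_fintype_card] at h0 h1 h2
  refine IsLeast.csInf_eq ⟨?_, fun i hi => ?_⟩
  · refine one_le_modDim _ (isPrime_PA A) (isPrime_PA (k := k) Finset.univ) ?_
      (le_trans (annihilator_extM _).le h2)
    refine lt_of_le_of_ne (PA_le_PA.2 (Finset.subset_univ A)) fun h => hA ?_
    exact Finset.univ_subset_iff.1 (PA_le_PA.1 h.ge)
  · by_contra hlt
    obtain rfl | rfl : i = 0 ∨ i = 1 := by lia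
    · have h3 := (nontrivial_extM_iff _).1 ((zero_le_modDim_iff _).1 hi)
      exact not_nontrivial_iff_subsingleton.2 h0 h3
    · have h3 := (nontrivial_extM_iff _).1 ((zero_le_modDim_iff _).1 hi)
      exact not_nontrivial_iff_subsingleton.2 h1 h3

end Socle

section DepthOne

variable {V : Type} [Fintype V] [DecidableEq V] {k : Type} [Field k]

lemma mem_IA_of_X_mul_mem {𝓕 : Finset (Finset V)} (h𝓕 : ∀ F ∈ 𝓕, F.Nonempty) {ℓ : ℕ}
    {p : MvPolynomial V k} (hp : ∀ i, X i * p ∈ IA k 𝓕 ℓ) : p ∈ IA k 𝓕 ℓ := by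
  refine mem_IA_of_sumX_mul_mem h𝓕 ℓ p ?_
  rw [sumX, Finset.sum_mul]
  exact Ideal.sum_mem _ fun i _ => hp i

lemma eq_zero_of_X_smul_eq_zero {𝓕 : Finset (Finset V)} (h𝓕 : ∀ F ∈ 𝓕, F.Nonempty) {ℓ : ℕ}
    (u : MvPolynomial V k ⧸ IA k 𝓕 ℓ) (hu : ∀ i, (X i : MvPolynomial V k) • u = 0) : u = 0 := by
  obtain ⟨p, rfl⟩ := Submodule.Quotient.mk_surjective _ u
  refine (Submodule.Quotient.mk_eq_zero _).2 (mem_IA_of_X_mul_mem h𝓕 fun i => ?_)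
  exact (Submodule.Quotient.mk_eq_zero _).1 (hu i)

lemma ext_zero_IA_subsingleton {𝓕 : Finset (Finset V)} (h𝓕 : ∀ F ∈ 𝓕, F.Nonempty) (ℓ : ℕ) :
    Subsingleton (Abelian.Ext (cyc (maxIdeal k V)) (cyc (IA k 𝓕 ℓ)) 0) :=
  ext_zero_subsingleton (M := cyc (IA k 𝓕 ℓ)) (eq_zero_of_X_smul_eq_zero h𝓕)

lemma pd_cyc_IA_of_nonempty [Nonempty V] {𝓕 : Finset (Finset V)} (h𝓕 : ∀ F ∈ 𝓕, F.Nonempty)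
    (ℓ : ℕ) : HasProjectiveDimensionLT (cyc (IA k 𝓕 ℓ)) (Fintype.card V) := by
  have hV : 0 < Fintype.card V := Fintype.card_pos
  have := pd_cyc_IA (k := k) Finset.univ (Fintype.card V - 1)
    (by rw [Finset.card_univ]; lia) ℓ 𝓕 fun F hF => ⟨Finset.subset_univ _, by
      have := (h𝓕 F hF).card_pos
      rw [Finset.card_compl]
      lia⟩
  rwa [Nat.sub_add_cancel hV] at this

lemma X_pow_mul_monomial (i : V) (m : ℕ) (a : V →₀ ℕ) :
    X i ^ m * monomial a (1 : k) = monomial (Finsupp.single i m + a) (1 : k) := by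
  rw [X_pow_eq_monomial, monomial_mul, one_mul]

lemma X_pow_mul_monomial_mem_IA {𝓕 : Finset (Finset V)} {ℓ : ℕ} {a : V →₀ ℕ} {i : V}
    (h : ∀ F ∈ 𝓕, wt Fᶜ a < ℓ → i ∉ F) : X i ^ ℓ * monomial a (1 : k) ∈ IA k 𝓕 ℓ := by
  rw [X_pow_mul_monomial, monomial_mem_IA]
  intro F hF
  rw [wt_add, wt_single]
  by_cases h' : wt Fᶜ a < ℓ
  · rw [if_pos (Finset.mem_compl.2 (h F hF h'))]
    lia
  · lia

theorem depth_eq_one_of_split {𝓕 : Finset (Finset V)} (h𝓕 : ∀ F ∈ 𝓕, F.Nonempty)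
    (c : Finset V → Prop) {ℓ : ℕ} (a : V →₀ ℕ) {F₀ G₀ : Finset V} (hF₀ : F₀ ∈ 𝓕) (hG₀ : G₀ ∈ 𝓕)
    (hF₀a : wt F₀ᶜ a < ℓ) (hG₀a : wt G₀ᶜ a < ℓ) (hF₀c : c F₀) (hG₀c : ¬ c G₀)
    (hdis : ∀ F ∈ 𝓕, ∀ G ∈ 𝓕, wt Fᶜ a < ℓ → wt Gᶜ a < ℓ → c F → ¬ c G → Disjoint F G) :
    mdepth k (cyc (IA k 𝓕 ℓ)) = 1 ∧ serreDepth k 2 (cyc (IA k 𝓕 ℓ)) = 1 := by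
  classical
  have : Nonempty V := ⟨(h𝓕 F₀ hF₀).choose⟩
  have hV : Fintype.card V - 1 + 1 = Fintype.card V := Nat.sub_add_cancel Fintype.card_pos
  set 𝓐 := 𝓕.filter c with h𝓐
  set 𝓑 := 𝓕.filter fun F => ¬ c F with h𝓑
  have h𝓐n : ∀ F ∈ 𝓐, F.Nonempty := fun F hF => h𝓕 F (Finset.mem_filter.1 hF).1
  have h𝓑n : ∀ F ∈ 𝓑, F.Nonempty := fun F hF => h𝓕 F (Finset.mem_filter.1 hF).1
  have hI : IA k 𝓕 ℓ = IA k 𝓐 ℓ ⊓ IA k 𝓑 ℓ := by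
    rw [← IA_union, h𝓐, h𝓑, Finset.filter_union_filter_not_eq]
  set Q := IA k 𝓐 ℓ ⊔ IA k 𝓑 ℓ with hQdef
  have hQ : IsMon Q := (isMon_IA 𝓐 ℓ).sup (isMon_IA 𝓑 ℓ)
  have haQ : monomial a (1 : k) ∉ Q := by
    intro h
    rcases (isMon_IA 𝓐 ℓ).monomial_mem_sup (isMon_IA 𝓑 ℓ) h with h | h <;>
      rw [monomial_mem_IA] at h
    · exact absurd (h F₀ (Finset.mem_filter.2 ⟨hF₀, hF₀c⟩)) (not_le.2 hF₀a)
    · exact absurd (h G₀ (Finset.mem_filter.2 ⟨hG₀, hG₀c⟩)) (not_le.2 hG₀a)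
  have hXQ : ∀ i, X i ^ ℓ * monomial a (1 : k) ∈ Q := by
    intro i
    by_cases hi : ∀ F ∈ 𝓐, wt Fᶜ a < ℓ → i ∉ F
    · exact Ideal.mem_sup_left (X_pow_mul_monomial_mem_IA hi)
    · push Not at hi
      obtain ⟨F, hF, hFa, hiF⟩ := hi
      refine Ideal.mem_sup_right (X_pow_mul_monomial_mem_IA fun G hG hGa hiG => ?_)
      have hF := Finset.mem_filter.1 hF
      have hG := Finset.mem_filter.1 hG
      exact Finset.disjoint_left.1 (hdis F hF.1 G hG.1 hFa hGa hF.2 hG.2) hiF hiG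
  obtain ⟨b, hb, hb'⟩ := exists_monomial_mul_mem_socle haQ ℓ hXQ
  rw [monomial_mul, one_mul] at hb hb'
  have hS := infSeq_shortExact (IA k 𝓐 ℓ) (IA k 𝓑 ℓ)
  have hprod : Subsingleton (Abelian.Ext (cyc (maxIdeal k V))
      (infSeq (IA k 𝓐 ℓ) (IA k 𝓑 ℓ)).X₂ 0) := by
    refine ext_zero_subsingleton fun u hu => ?_
    exact Prod.ext
      (eq_zero_of_X_smul_eq_zero h𝓐n _ fun i => congrArg Prod.fst (hu i))
      (eq_zero_of_X_smul_eq_zero h𝓑n _ fun i => congrArg Prod.snd (hu i))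
  have hpd := pd_prod (pd_cyc_IA_of_nonempty (k := k) h𝓐n ℓ) (pd_cyc_IA_of_nonempty (k := k) h𝓑n ℓ)
  have hE : Nontrivial (Abelian.Ext (cyc (IA k 𝓕 ℓ)) (polyMod V k) (Fintype.card V - 1)) := by
    rw [hI]
    refine ext_contra_nontrivial_X₁ hS (polyMod V k) ?_ ?_
    · rw [hV]
      exact ext_subsingleton_of_pd hpd le_rfl
    · rw [hV]
      exact ext_card_nontrivial hQ hb hb'
  refine ⟨mdepth_eq_one (ext_zero_IA_subsingleton h𝓕 ℓ) ?_,
    serreDepth_two_eq_one (ext_subsingleton_of_pd (pd_cyc_IA_of_nonempty h𝓕 ℓ) le_rfl) hE⟩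
  rw [hI]
  exact ext_nontrivial_X₁ hS _ hprod (ext_zero_nontrivial hb hb')

end DepthOne

section Parameters

variable {V : Type} [Fintype V] [DecidableEq V] {k : Type} [Field k]

/-- The sum of the monomials attached to the sets in `𝓕`. -/
def sumFaces (k : Type) [Field k] (𝓕 : Finset (Finset V)) : MvPolynomial V k :=
  ∑ F ∈ 𝓕, ∏ i ∈ F, X i

lemma sumX_mem_maxIdeal : sumX V k ∈ maxIdeal k V :=
  Ideal.sum_mem _ fun i _ => X_mem_maxIdeal i

lemma sumFaces_mem_maxIdeal {𝓕 : Finset (Finset V)} (h𝓕 : ∀ F ∈ 𝓕, F.card = 2) :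
    sumFaces k 𝓕 ∈ maxIdeal k V := by
  refine Ideal.sum_mem _ fun F hF => ?_
  obtain ⟨i, hi⟩ : F.Nonempty := Finset.card_pos.1 (by rw [h𝓕 F hF]; norm_num)
  exact Ideal.mem_of_dvd _ (Finset.dvd_prod_of_mem _ hi) (X_mem_maxIdeal i)

lemma cubic_mem_PA {𝓕 : Finset (Finset V)} (h𝓕 : ∀ F ∈ 𝓕, F.card = 2) {F : Finset V}
    (hF : F ∈ 𝓕) (i : V) :
    X i * (X i ^ 2 - sumX V k * X i + sumFaces k 𝓕) ∈ PA k Fᶜ := by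
  obtain ⟨u, v, huv, rfl⟩ := Finset.card_eq_two.1 (h𝓕 F hF)
  set P := PA k ({u, v} : Finset V)ᶜ with hP
  have hs : sumX V k - (X u + X v) ∈ P := by
    have : sumX V k - (X u + X v) = ∑ j ∈ ({u, v} : Finset V)ᶜ, X j := by
      rw [sumX, ← Finset.sum_add_sum_compl {u, v}, Finset.sum_pair huv, add_sub_cancel_left]
    rw [this]
    exact Ideal.sum_mem _ fun j hj => X_mem_PA.2 hj
  have ht : sumFaces k 𝓕 - X u * X v ∈ P := by
    have : sumFaces k 𝓕 - X u * X v = ∑ G ∈ 𝓕.erase {u, v}, ∏ j ∈ G, X j := by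
      rw [sumFaces, ← Finset.add_sum_erase _ _ hF, Finset.prod_pair huv, add_sub_cancel_left]
    rw [this]
    refine Ideal.sum_mem _ fun G hG => ?_
    have hG' := Finset.mem_erase.1 hG
    have hnot : ¬ G ⊆ {u, v} := fun hsub => hG'.1
      (Finset.eq_of_subset_of_card_le hsub (by rw [h𝓕 G hG'.2, h𝓕 _ hF]))
    obtain ⟨j, hj, hj'⟩ := Finset.not_subset.1 hnot
    exact Ideal.mem_of_dvd _ (Finset.dvd_prod_of_mem _ hj) (X_mem_PA.2 (Finset.mem_compl.2 hj'))
  have h0 : X i * ((X i - X u) * (X i - X v)) ∈ P := by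
    by_cases hi : i ∈ ({u, v} : Finset V)
    · rcases Finset.mem_insert.1 hi with rfl | hi
      · simp
      · rw [Finset.mem_singleton.1 hi]
        simp
    · exact Ideal.mul_mem_right _ _ (X_mem_PA.2 (Finset.mem_compl.2 hi))
  have := add_mem h0 (sub_mem (P.mul_mem_left (X i) ht) (P.mul_mem_left (X i ^ 2) hs))
  convert this using 1
  ring

lemma X_pow_mem_sup {𝓕 : Finset (Finset V)} (h𝓕 : ∀ F ∈ 𝓕, F.card = 2) (ℓ : ℕ) (i : V) :
    X i ^ (3 * ℓ) ∈ IA k 𝓕 ℓ ⊔ Ideal.span {sumX V k} ⊔ Ideal.span {sumFaces k 𝓕} := by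
  set J := IA k 𝓕 ℓ ⊔ Ideal.span {sumX V k} ⊔ Ideal.span {sumFaces k 𝓕}
  set y : MvPolynomial V k := X i * (X i ^ 2 - sumX V k * X i + sumFaces k 𝓕) with hy
  have h1 : y ^ ℓ ∈ J := by
    refine Ideal.mem_sup_left (Ideal.mem_sup_left (mem_IA'.2 fun F hF => ?_))
    exact Ideal.pow_mem_pow (cubic_mem_PA h𝓕 hF i) ℓ
  have h2 : X i ^ 3 - y ∈ J := by
    have hs : sumX V k ∈ J :=
      Ideal.mem_sup_left (Ideal.mem_sup_right (Ideal.mem_span_singleton_self _))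
    have ht : sumFaces k 𝓕 ∈ J := Ideal.mem_sup_right (Ideal.mem_span_singleton_self _)
    have := sub_mem (J.mul_mem_left (X i ^ 2) hs) (J.mul_mem_left (X i) ht)
    convert this using 1
    rw [hy]
    ring
  have h3 := add_mem (J.mem_of_dvd (sub_dvd_pow_sub_pow (X i ^ 3) y ℓ) h2) h1
  rwa [sub_add_cancel, ← pow_mul] at h3

/-- The connectedness property governing depth two: a function which is constant on each of the
sets of `𝓕` of small weight is constant on their union. -/
def WeightConnected (k : Type) [Field k] (𝓕 : Finset (Finset V)) (ℓ : ℕ) : Prop :=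
  ∀ (a : V →₀ ℕ) (c : V → k),
    (∀ F ∈ 𝓕, wt Fᶜ a < ℓ → ∀ i ∈ F, ∀ j ∈ F, c i = c j) →
    ∀ F ∈ 𝓕, ∀ G ∈ 𝓕, wt Fᶜ a < ℓ → wt Gᶜ a < ℓ → ∀ i ∈ F, ∀ j ∈ G, c i = c j

lemma coeff_eq_zero_of_mem_IA {𝓕 : Finset (Finset V)} {ℓ : ℕ} {p : MvPolynomial V k}
    (hp : p ∈ IA k 𝓕 ℓ) {F : Finset V} (hF : F ∈ 𝓕) {b : V →₀ ℕ} (hb : wt Fᶜ b < ℓ) :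
    coeff b p = 0 := by
  by_contra h
  exact absurd (mem_IA.1 hp b (mem_support_iff.2 h) F hF) (not_le.2 hb)

lemma mem_IA_of_coeff {𝓕 : Finset (Finset V)} {ℓ : ℕ} {p : MvPolynomial V k}
    (h : ∀ b, ∀ F ∈ 𝓕, wt Fᶜ b < ℓ → coeff b p = 0) : p ∈ IA k 𝓕 ℓ :=
  mem_IA.2 fun b hb F hF => not_lt.1 fun hlt => (mem_support_iff.1 hb) (h b F hF hlt)

lemma wt_compl_add_single_of_mem {F : Finset V} {i : V} (hi : i ∈ F) (a : V →₀ ℕ) :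
    wt Fᶜ (a + Finsupp.single i 1) = wt Fᶜ a := by
  rw [wt_add, wt_single, if_neg (by simpa using hi), add_zero]

lemma exists_poly_coeff (γ : (V →₀ ℕ) → k) (hγ : {a | γ a ≠ 0}.Finite) :
    ∃ g : MvPolynomial V k, ∀ a, coeff a g = γ a := by
  classical
  refine ⟨∑ a ∈ hγ.toFinset, monomial a (γ a), fun a => ?_⟩
  rw [coeff_sum]
  simp only [coeff_monomial]
  rw [Finset.sum_ite_eq' hγ.toFinset a γ]
  split_ifs with h
  · rfl
  · by_contra h'
    exact h (hγ.mem_toFinset.2 (Ne.symm h'))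

lemma exists_common_factor {𝓕 : Finset (Finset V)} (h𝓕 : ∀ F ∈ 𝓕, F.card = 2) {ℓ : ℕ}
    (hconn : WeightConnected k 𝓕 ℓ) (h : V → MvPolynomial V k)
    (hh : ∀ i j, X j * h i - X i * h j ∈ IA k 𝓕 ℓ) :
    ∃ g, ∀ v, h v - X v * g ∈ IA k 𝓕 ℓ := by
  classical
  have hrel (a : V →₀ ℕ) (i j : V) (F : Finset V) (hF : F ∈ 𝓕)
      (hwt : wt Fᶜ (a + Finsupp.single i 1 + Finsupp.single j 1) < ℓ) :
      coeff (a + Finsupp.single i 1) (h i) = coeff (a + Finsupp.single j 1) (h j) := by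
    have h0 := coeff_eq_zero_of_mem_IA (hh i j) hF hwt
    rw [coeff_sub, mul_comm (X j), coeff_mul_X, add_right_comm, mul_comm (X i), coeff_mul_X,
      sub_eq_zero] at h0
    exact h0
  have hconst (a : V →₀ ℕ) : ∀ F ∈ 𝓕, ∀ G ∈ 𝓕, wt Fᶜ a < ℓ → wt Gᶜ a < ℓ → ∀ i ∈ F, ∀ j ∈ G,
      coeff (a + Finsupp.single i 1) (h i) = coeff (a + Finsupp.single j 1) (h j) := by
    refine hconn a (fun i => coeff (a + Finsupp.single i 1) (h i)) fun F hF hFa i hi j hj => ?_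
    refine hrel a i j F hF ?_
    rwa [wt_compl_add_single_of_mem hj, wt_compl_add_single_of_mem hi]
  let good (a : V →₀ ℕ) : Prop := ∃ i F, F ∈ 𝓕 ∧ wt Fᶜ a < ℓ ∧ i ∈ F
  let γ (a : V →₀ ℕ) : k :=
    if hg : good a then coeff (a + Finsupp.single hg.choose 1) (h hg.choose) else 0
  have hγ (a : V →₀ ℕ) (i : V) (F : Finset V) (hF : F ∈ 𝓕) (hFa : wt Fᶜ a < ℓ) (hi : i ∈ F) :
      γ a = coeff (a + Finsupp.single i 1) (h i) := by
    have hg : good a := ⟨i, F, hF, hFa, hi⟩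
    obtain ⟨G, hG, hGa, hiG⟩ := hg.choose_spec
    exact (dif_pos hg).trans (hconst a G hG F hF hGa hFa _ hiG i hi)
  have hfin : {a | γ a ≠ 0}.Finite := by
    have hU : (⋃ i : V, (fun a : V →₀ ℕ => a + Finsupp.single i 1) ⁻¹'
        ((h i).support : Set (V →₀ ℕ))).Finite :=
      Set.finite_iUnion fun i =>
        (h i).support.finite_toSet.preimage (add_left_injective _).injOn
    refine hU.subset fun a ha => ?_
    have hg : good a := by
      by_contra hg
      exact ha (dif_neg hg)
    refine Set.mem_iUnion.2 ⟨hg.choose, ?_⟩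
    have : γ a = coeff (a + Finsupp.single hg.choose 1) (h hg.choose) := dif_pos hg
    exact mem_support_iff.2 (this ▸ ha)
  obtain ⟨g, hg⟩ := exists_poly_coeff γ hfin
  refine ⟨g, fun v => mem_IA_of_coeff fun b F hF hFb => ?_⟩
  rw [coeff_sub]
  by_cases hbv : b v = 0
  · have h1 : coeff b (X v * g) = 0 := by
      rw [mul_comm, coeff_mul_X', if_neg (by simpa using hbv)]
    obtain ⟨i, hi, hiv⟩ := Finset.exists_mem_ne (by rw [h𝓕 F hF]; norm_num) v
    have h2 := coeff_eq_zero_of_mem_IA (hh v i) hF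
      (b := b + Finsupp.single i 1) (by rwa [wt_compl_add_single_of_mem hi])
    have h3 : coeff (b + Finsupp.single i 1) (X v * h i) = 0 := by
      rw [mul_comm, coeff_mul_X', if_neg]
      simp [hbv, hiv]
    rw [coeff_sub, h3, mul_comm, coeff_mul_X, sub_zero] at h2
    rw [h1, h2, sub_zero]
  · obtain ⟨a, rfl⟩ := exists_eq_single_add hbv
    rw [add_comm] at hFb
    have hFa : wt Fᶜ a < ℓ := lt_of_le_of_lt (wt_mono le_self_add) hFb
    obtain ⟨i, hi⟩ : F.Nonempty := Finset.card_pos.1 (by rw [h𝓕 F hF]; norm_num)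
    rw [add_comm, mul_comm, coeff_mul_X, hg, hγ a i F hF hFa hi, sub_eq_zero]
    refine hrel a v i F hF ?_
    rwa [wt_compl_add_single_of_mem hi]

lemma nonempty_of_card_eq_two {𝓕 : Finset (Finset V)} (h𝓕 : ∀ F ∈ 𝓕, F.card = 2) :
    ∀ F ∈ 𝓕, F.Nonempty :=
  fun F hF => Finset.card_pos.1 (by rw [h𝓕 F hF]; norm_num)

lemma mem_sup_sumX_of_X_mul_mem {𝓕 : Finset (Finset V)} (h𝓕 : ∀ F ∈ 𝓕, F.card = 2) {ℓ : ℕ}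
    (hconn : WeightConnected k 𝓕 ℓ) {u : MvPolynomial V k}
    (hu : ∀ i, X i * u ∈ IA k 𝓕 ℓ ⊔ Ideal.span {sumX V k}) :
    u ∈ IA k 𝓕 ℓ ⊔ Ideal.span {sumX V k} := by
  have hex : ∀ i, ∃ h, X i * u - sumX V k * h ∈ IA k 𝓕 ℓ := by
    intro i
    obtain ⟨q, hq, r, hr, hqr⟩ := Submodule.mem_sup.1 (hu i)
    obtain ⟨h, rfl⟩ := Ideal.mem_span_singleton'.1 hr
    refine ⟨h, ?_⟩
    rwa [← hqr, mul_comm h, add_sub_cancel_right]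
  choose h hh using hex
  have hne := nonempty_of_card_eq_two h𝓕
  obtain ⟨g, hg⟩ := exists_common_factor h𝓕 hconn h fun i j => by
    refine mem_IA_of_sumX_mul_mem hne ℓ _ ?_
    have := sub_mem (Ideal.mul_mem_left _ (X i) (hh j)) (Ideal.mul_mem_left _ (X j) (hh i))
    convert this using 1
    ring
  have h1 : u - sumX V k * g ∈ IA k 𝓕 ℓ := by
    refine mem_IA_of_X_mul_mem hne fun i => ?_
    have := add_mem (hh i) (Ideal.mul_mem_left _ (sumX V k) (hg i))
    convert this using 1
    ring
  have := add_mem (Ideal.mem_sup_left (T := Ideal.span {sumX V k}) h1)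
    (Ideal.mem_sup_right (S := IA k 𝓕 ℓ)
      (Ideal.mul_mem_right g _ (Ideal.mem_span_singleton_self (sumX V k))))
  rwa [sub_add_cancel] at this

lemma mem_of_sumFaces_mul_mem {𝓕 : Finset (Finset V)} (h𝓕 : ∀ F ∈ 𝓕, F.card = 2) {ℓ : ℕ}
    (hconn : WeightConnected k 𝓕 ℓ) (p : MvPolynomial V k)
    (hp : sumFaces k 𝓕 * p ∈ IA k 𝓕 ℓ ⊔ Ideal.span {sumX V k}) :
    p ∈ IA k 𝓕 ℓ ⊔ Ideal.span {sumX V k} := by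
  by_contra hpn
  obtain ⟨b, hb, hb'⟩ := exists_monomial_mul_mem_socle hpn (3 * ℓ) fun i => by
    obtain ⟨q, hq, r, hr, hqr⟩ := Submodule.mem_sup.1 (X_pow_mem_sup (k := k) h𝓕 ℓ i)
    obtain ⟨r, rfl⟩ := Ideal.mem_span_singleton'.1 hr
    rw [← hqr, add_mul, mul_assoc]
    exact add_mem (Ideal.mul_mem_right _ _ hq) (Ideal.mul_mem_left _ _ hp)
  exact hb (mem_sup_sumX_of_X_mul_mem h𝓕 hconn hb')

lemma ext_zero_sup_sumX_subsingleton {𝓕 : Finset (Finset V)} (h𝓕 : ∀ F ∈ 𝓕, F.card = 2) {ℓ : ℕ}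
    (hconn : WeightConnected k 𝓕 ℓ) :
    Subsingleton (Abelian.Ext (cyc (maxIdeal k V))
      (cyc (IA k 𝓕 ℓ ⊔ Ideal.span {sumX V k})) 0) := by
  refine ext_zero_subsingleton (M := cyc (IA k 𝓕 ℓ ⊔ Ideal.span {sumX V k})) fun u hu => ?_
  change MvPolynomial V k ⧸ _ at u
  obtain ⟨p, rfl⟩ := Submodule.Quotient.mk_surjective _ u
  refine (Submodule.Quotient.mk_eq_zero _).2 (mem_sup_sumX_of_X_mul_mem h𝓕 hconn fun i => ?_)
  exact (Submodule.Quotient.mk_eq_zero _).1 (hu i)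

lemma IA_le_maxIdeal {𝓕 : Finset (Finset V)} (h𝓕 : 𝓕.Nonempty) {ℓ : ℕ} (hℓ : 1 ≤ ℓ) :
    IA k 𝓕 ℓ ≤ maxIdeal k V := by
  obtain ⟨F, hF⟩ := h𝓕
  refine le_trans (Finset.inf_le hF) ((Ideal.pow_le_self (by lia)).trans ?_)
  rw [← PA_univ]
  exact PA_le_PA.2 (Finset.subset_univ _)

theorem mdepth_eq_two_of_weightConnected {𝓕 : Finset (Finset V)} (h0 : 𝓕.Nonempty)
    (h𝓕 : ∀ F ∈ 𝓕, F.card = 2) {ℓ : ℕ} (hℓ : 1 ≤ ℓ) (hconn : WeightConnected k 𝓕 ℓ) :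
    mdepth k (cyc (IA k 𝓕 ℓ)) = 2 := by
  have hne := nonempty_of_card_eq_two h𝓕
  have hT0 := ext_zero_sup_sumX_subsingleton h𝓕 hconn
  have hM1 := ext_succ_subsingleton_of_regular sumX_mem_maxIdeal
    (mem_IA_of_sumX_mul_mem (k := k) hne ℓ) hT0
  have hnot : (1 : MvPolynomial V k) ∉
      IA k 𝓕 ℓ ⊔ Ideal.span {sumX V k} ⊔ Ideal.span {sumFaces k 𝓕} := by
    intro h
    have hle : IA k 𝓕 ℓ ⊔ Ideal.span {sumX V k} ⊔ Ideal.span {sumFaces k 𝓕} ≤ maxIdeal k V :=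
      sup_le (sup_le (IA_le_maxIdeal h0 hℓ)
        ((Ideal.span_singleton_le_iff_mem _).2 sumX_mem_maxIdeal))
        ((Ideal.span_singleton_le_iff_mem _).2 (sumFaces_mem_maxIdeal h𝓕))
    have := mem_maxIdeal_iff.1 (hle h)
    rw [map_one] at this
    exact one_ne_zero this
  obtain ⟨b, hb, hb'⟩ := exists_monomial_mul_mem_socle hnot (3 * ℓ) fun i => by
    rw [mul_one]
    exact X_pow_mem_sup h𝓕 ℓ i
  have hT1 := ext_succ_nontrivial_of_regular (mem_of_sumFaces_mul_mem h𝓕 hconn) hT0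
    (ext_zero_nontrivial hb hb')
  exact mdepth_eq_two (ext_zero_IA_subsingleton hne ℓ) hM1
    (ext_succ_nontrivial_of_regular (mem_IA_of_sumX_mul_mem (k := k) hne ℓ) hM1 hT1)

end Parameters

section SerreDepthTwo

lemma mulMap_comp_comp {R : Type} [CommRing R] (I J L : Ideal R) (x y : R)
    (h : ∀ p ∈ I, x * p ∈ J) (h' : ∀ p ∈ J, y * p ∈ L) (h'' : ∀ p ∈ I, (y * x) * p ∈ L)
    {Y : ModuleCat.{0} R} {n : ℕ} (e : Abelian.Ext (cyc L) Y n) :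
    (Abelian.Ext.mk₀ (mulMap I J x h)).comp
      ((Abelian.Ext.mk₀ (mulMap J L y h')).comp e (zero_add n)) (zero_add n) =
    (Abelian.Ext.mk₀ (mulMap I L (y * x) h'')).comp e (zero_add n) := by
  rw [Abelian.Ext.mk₀_comp_mk₀_assoc, mulMap_comp I J L x y h h' h'']

lemma smul_ext_eq_zero_of_factor {R : Type} [CommRing R] {I J : Ideal R} {x : R} (hIJ : I ≤ J)
    (h : ∀ p ∈ J, x * p ∈ I) {Y : ModuleCat.{0} R} {n : ℕ}
    (hJ : Subsingleton (Abelian.Ext (cyc J) Y n)) (e : Abelian.Ext (cyc I) Y n) : x • e = 0 := by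
  have h1 := mulMap_comp_comp I J I 1 x (fun p hp => by rw [one_mul]; exact hIJ hp) h
    (fun p hp => I.mul_mem_left _ hp) e
  rw [mulMap_precomp, mul_one] at h1
  rw [← h1, hJ.elim ((Abelian.Ext.mk₀ (mulMap J I x h)).comp e (zero_add n)) 0]
  exact Abelian.Ext.comp_zero _ _ _ _ _

/-- Multiplication by an element killing `Ext (cyc I) Y i` also kills `Ext (cyc (I + (x))) Y (i+1)`
when `x` is regular and `Ext (cyc I) Y (i+1)` vanishes. -/
lemma smul_ext_succ_eq_zero {R : Type} [CommRing R] {I : Ideal R} {x r : R}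
    (hreg : ∀ p, x * p ∈ I → p ∈ I) {Y : ModuleCat.{0} R} {i : ℕ}
    (h : Subsingleton (Abelian.Ext (cyc I) Y (i + 1)))
    (hr : ∀ e : Abelian.Ext (cyc I) Y i, r • e = 0)
    (e : Abelian.Ext (cyc (I ⊔ Ideal.span {x})) Y (i + 1)) : r • e = 0 := by
  have hS := colonSeq_shortExact I I _ x (fun p => ⟨fun hp => I.mul_mem_left x hp, hreg p⟩) rfl
  obtain ⟨y, hy⟩ := Abelian.Ext.contravariant_sequence_exact₃ hS Y e (h.elim _ _) (add_comm 1 i)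
  rw [← hy]
  refine (Abelian.Ext.comp_smul _ _ _ _).symm.trans ?_
  exact (congrArg (fun z => hS.extClass.comp z (add_comm 1 i)) (hr y)).trans
    (Abelian.Ext.comp_zero _ _ _ _ _)

variable {V : Type} [Fintype V] [DecidableEq V] {k : Type} [Field k]

lemma X_pow_mul_mem_IA {𝓕 : Finset (Finset V)} {ℓ : ℕ} {i : V} {p : MvPolynomial V k}
    (hp : p ∈ IA k (𝓕.filter (i ∈ ·)) ℓ) : X i ^ ℓ * p ∈ IA k 𝓕 ℓ := by
  refine mem_IA'.2 fun F hF => ?_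
  by_cases hi : i ∈ F
  · exact Ideal.mul_mem_left _ _ (mem_IA'.1 hp F (Finset.mem_filter.2 ⟨hF, hi⟩))
  · exact Ideal.mul_mem_right _ _
      (Ideal.pow_mem_pow (X_mem_PA.2 (Finset.mem_compl.2 hi)) ℓ)

lemma card_compl_of_card_eq_two {F : Finset V} (hF : F.card = 2) :
    Fᶜ.card = Fintype.card V - 2 := by
  rw [Finset.card_compl, hF]

lemma two_le_card_of_card_eq_two {F : Finset V} (hF : F.card = 2) : 2 ≤ Fintype.card V :=
  hF ▸ Finset.card_le_univ F

lemma X_pow_smul_ext_eq_zero {𝓕 : Finset (Finset V)} (h0 : 𝓕.Nonempty)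
    (h𝓕 : ∀ F ∈ 𝓕, F.card = 2) (ℓ : ℕ) (i : V)
    (e : Abelian.Ext (cyc (IA k 𝓕 ℓ)) (polyMod V k) (Fintype.card V - 1)) :
    (X i : MvPolynomial V k) ^ ℓ • e = 0 := by
  have hV : 2 ≤ Fintype.card V := two_le_card_of_card_eq_two (h𝓕 _ h0.choose_spec)
  have hpd : HasProjectiveDimensionLT (cyc (IA k (𝓕.filter (i ∈ ·)) ℓ))
      (Fintype.card V - 2 + 1) := by
    refine pd_cyc_IA {i}ᶜ _ ?_ ℓ _ fun F hF => ⟨?_, ?_⟩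
    · rw [Finset.card_compl, Finset.card_singleton]
      lia
    · exact Finset.compl_subset_compl.2 (Finset.singleton_subset_iff.2 (Finset.mem_filter.1 hF).2)
    · exact (card_compl_of_card_eq_two (h𝓕 F (Finset.mem_filter.1 hF).1)).le
  exact smul_ext_eq_zero_of_factor (IA_anti (Finset.filter_subset _ _) _)
    (fun p hp => X_pow_mul_mem_IA hp) (ext_subsingleton_of_pd hpd (by lia)) e

lemma ext_IA_subsingleton {𝓕 : Finset (Finset V)} (h0 : 𝓕.Nonempty)
    (h𝓕 : ∀ F ∈ 𝓕, F.card = 2) {ℓ : ℕ} (hconn : WeightConnected k 𝓕 ℓ) :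
    Subsingleton (Abelian.Ext (cyc (IA k 𝓕 ℓ)) (polyMod V k) (Fintype.card V - 1)) := by
  have hV : 2 ≤ Fintype.card V := two_le_card_of_card_eq_two (h𝓕 _ h0.choose_spec)
  have : Nonempty V := Fintype.card_pos_iff.1 (by lia)
  have hne := nonempty_of_card_eq_two h𝓕
  have hX := X_pow_smul_ext_eq_zero (k := k) h0 h𝓕 ℓ
  have hV' : Fintype.card V - 1 + 1 = Fintype.card V := by lia
  have htop : Subsingleton (Abelian.Ext (cyc (IA k 𝓕 ℓ)) (polyMod V k)
      (Fintype.card V - 1 + 1)) :=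
    ext_subsingleton_of_pd (pd_cyc_IA_of_nonempty hne ℓ) hV'.ge
  have hT (i : V) := smul_ext_succ_eq_zero (mem_IA_of_sumX_mul_mem (k := k) hne ℓ) htop (hX i)
  obtain ⟨N, hN⟩ := exists_pow_smul_eq_zero hT (sumFaces_mem_maxIdeal h𝓕)
  have hTop : Subsingleton (Abelian.Ext (cyc (IA k 𝓕 ℓ ⊔ Ideal.span {sumX V k})) (polyMod V k)
      (Fintype.card V - 1 + 1)) := by
    refine ext_subsingleton_of_pow_smul (mem_of_sumFaces_mul_mem h𝓕 hconn) ?_ hN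
    exact ext_subsingleton_of_pd (pd_cyc_of_pow_mem (3 * ℓ) _ (X_pow_mem_sup h𝓕 ℓ)) (by lia)
  obtain ⟨N', hN'⟩ := exists_pow_smul_eq_zero hX sumX_mem_maxIdeal
  exact ext_subsingleton_of_pow_smul (mem_IA_of_sumX_mul_mem (k := k) hne ℓ) hTop hN'

lemma exists_colon_eq_PA (A : Finset V) {ℓ : ℕ} (hℓ : 1 ≤ ℓ) :
    ∃ b : V →₀ ℕ, (∀ i ∉ A, b i = 0) ∧
      ∀ p, p ∈ PA k A ↔ monomial b (1 : k) * p ∈ PA k A ^ ℓ := by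
  rcases A.eq_empty_or_nonempty with rfl | ⟨v, hv⟩
  · refine ⟨0, fun i _ => rfl, fun p => ?_⟩
    rw [PA_empty, monomial_zero', C_1, one_mul, ← Ideal.zero_eq_bot, zero_pow (by lia)]
  · refine ⟨Finsupp.single v (ℓ - 1), fun i hi => ?_, fun p => ?_⟩
    · exact Finsupp.single_eq_of_ne fun h => hi (h ▸ hv)
    rw [(isMon_PA A).mem_iff]
    change _ ↔ p ∈ colonI (PA k A ^ ℓ) (monomial (Finsupp.single v (ℓ - 1)) (1 : k))
    rw [((isMon_PA_pow A ℓ).colon_monomial _).mem_iff]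
    refine forall₂_congr fun c _ => ?_
    rw [mem_colonI, monomial_mul, one_mul, monomial_mem_PA_pow_iff, wt_add, wt_single, if_pos hv,
      ← pow_one (PA k A), monomial_mem_PA_pow_iff]
    lia

lemma colonI_sup_span_monomial_le {A : Finset V} {ℓ : ℕ} {b : V →₀ ℕ}
    (hb : ∀ i ∉ A, b i = 0) {i : V} (hi : i ∉ A) :
    colonI (PA k A ^ ℓ ⊔ Ideal.span {monomial b (1 : k)}) (X i) ≤
      PA k A ^ ℓ ⊔ Ideal.span {monomial b (1 : k)} := by
  refine colon_sup_le (isMon_PA_pow _ _) (isMon_span_monomial _) (colon_PA_pow_le ℓ hi) ?_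
  intro p hp
  rw [mem_span_monomial_singleton]
  intro c hc j
  have h1 := (mem_span_monomial_singleton b _).1 hp (Finsupp.single i 1 + c)
    (mem_support_monomial_mul.2 hc) j
  by_cases hj : j = i
  · rw [hj, hb i hi]
    exact Nat.zero_le _
  · simpa [Ne.symm hj] using h1

lemma prod_pow_mul_mem_IA {𝓕 : Finset (Finset V)} (h𝓕 : ∀ F ∈ 𝓕, F.card = 2) {ℓ : ℕ}
    {F : Finset V} (hF : F ∈ 𝓕) {p : MvPolynomial V k} (hp : p ∈ PA k Fᶜ ^ ℓ) :
    (∏ i ∈ F, X i) ^ ℓ * p ∈ IA k 𝓕 ℓ := by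
  refine mem_IA'.2 fun G hG => ?_
  by_cases hGF : F ⊆ G
  · rw [← Finset.eq_of_subset_of_card_le hGF (by rw [h𝓕 F hF, h𝓕 G hG])]
    exact Ideal.mul_mem_left _ _ hp
  · obtain ⟨j, hj, hj'⟩ := Finset.not_subset.1 hGF
    refine Ideal.mul_mem_right _ _ (Ideal.pow_mem_pow ?_ ℓ)
    exact Ideal.mem_of_dvd _ (Finset.dvd_prod_of_mem _ hj) (X_mem_PA.2 (Finset.mem_compl.2 hj'))

lemma exists_generator_lift (A : Finset V) {ℓ : ℕ} (hℓ : 1 ≤ ℓ) :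
    ∃ y : Abelian.Ext (cyc (PA k A ^ ℓ)) (polyMod V k) A.card,
      ∀ g : MvPolynomial V k, g • y = 0 → g ∈ PA k A := by
  obtain ⟨b, hb, hcolon⟩ := exists_colon_eq_PA (k := k) A hℓ
  obtain ⟨e, -, he⟩ := exists_generator_ext_PA (k := k) A
  have hS := colonSeq_shortExact (PA k A) (PA k A ^ ℓ) _ (monomial b (1 : k)) hcolon rfl
  have hpd := pd_cyc_of_isMon A ((isMon_PA_pow (k := k) A ℓ).sup (isMon_span_monomial b))
    fun i hi => colonI_sup_span_monomial_le hb hi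
  obtain ⟨y, rfl⟩ := ext_contra_precomp_surjective hS (polyMod V k)
    (ext_subsingleton_of_pd hpd le_rfl) e
  refine ⟨y, fun g hg => (he g).1 ?_⟩
  refine (Abelian.Ext.comp_smul _ _ _ _).symm.trans ?_
  exact (congrArg (fun z => (Abelian.Ext.mk₀ (colonSeq (PA k A) (PA k A ^ ℓ) _
    (monomial b (1 : k)) hcolon rfl).f).comp z (zero_add _)) hg).trans
    (Abelian.Ext.comp_zero _ _ _ _ _)

lemma annihilator_ext_IA_le {𝓕 : Finset (Finset V)} (h𝓕 : ∀ F ∈ 𝓕, F.card = 2) {ℓ : ℕ}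
    (hℓ : 1 ≤ ℓ) {F : Finset V} (hF : F ∈ 𝓕) :
    Module.annihilator (MvPolynomial V k)
      (Abelian.Ext (cyc (IA k 𝓕 ℓ)) (polyMod V k) (Fintype.card V - 2)) ≤ PA k Fᶜ := by
  intro r hr
  rw [← card_compl_of_card_eq_two (h𝓕 F hF), Module.mem_annihilator] at hr
  obtain ⟨y, hy⟩ := exists_generator_lift (k := k) Fᶜ hℓ
  have hmul : r * (∏ i ∈ F, X i) ^ ℓ ∈ PA k Fᶜ := by
    refine hy _ ?_
    have h1 := mulMap_comp_comp (PA k Fᶜ ^ ℓ) (IA k 𝓕 ℓ) (PA k Fᶜ ^ ℓ) ((∏ i ∈ F, X i) ^ ℓ) 1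
      (fun p hp => prod_pow_mul_mem_IA h𝓕 hF hp)
      (fun p hp => by rw [one_mul]; exact mem_IA'.1 hp F hF)
      (fun p hp => Ideal.mul_mem_left _ _ hp) y
    rw [mulMap_precomp, one_mul] at h1
    rw [mul_smul, ← h1, ← Abelian.Ext.comp_smul, hr]
    exact Abelian.Ext.comp_zero _ _ _ _ _
  refine ((isPrime_PA (k := k) Fᶜ).mem_or_mem hmul).resolve_right fun h => ?_
  obtain ⟨i, hi, hi'⟩ := (isPrime_PA (k := k) Fᶜ).prod_mem_iff.1
    ((isPrime_PA (k := k) Fᶜ).mem_of_pow_mem _ h)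
  exact Finset.mem_compl.1 (X_mem_PA.1 hi') hi

theorem serreDepth_eq_two_of_weightConnected {𝓕 : Finset (Finset V)} (h0 : 𝓕.Nonempty)
    (h𝓕 : ∀ F ∈ 𝓕, F.card = 2) {ℓ : ℕ} (hℓ : 1 ≤ ℓ) (hconn : WeightConnected k 𝓕 ℓ) :
    serreDepth k 2 (cyc (IA k 𝓕 ℓ)) = 2 := by
  have hne := nonempty_of_card_eq_two h𝓕
  have hV : 2 ≤ Fintype.card V := two_le_card_of_card_eq_two (h𝓕 _ h0.choose_spec)
  have : Nonempty V := Fintype.card_pos_iff.1 (by lia)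
  obtain ⟨F, hF⟩ := h0
  refine serreDepth_two_eq_two (ext_subsingleton_of_pd (pd_cyc_IA_of_nonempty hne ℓ) le_rfl)
    (ext_IA_subsingleton ⟨F, hF⟩ h𝓕 hconn) (A := Fᶜ) ?_ (annihilator_ext_IA_le h𝓕 hℓ hF)
  rw [Ne, Finset.compl_eq_univ_iff]
  exact (hne F hF).ne_empty

end SerreDepthTwo

section Graphs

variable {V : Type} [Fintype V] [DecidableEq V] {K : Set (Finset V)}

/-- The exchange property of a one-dimensional complex: every vertex outside of an edge is
adjacent to one of the endpoints of the edge. -/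
def EdgeExchange (K : Set (Finset V)) : Prop :=
  ∀ w i j : V, {w} ∈ K → i ≠ j → ({i, j} : Finset V) ∈ K → w ≠ i → w ≠ j →
    ({w, i} : Finset V) ∈ K ∨ ({w, j} : Finset V) ∈ K

lemma pair_mem (hK : IsComplex K) {F : Finset V} (hF : F ∈ K) {x y : V} (hx : x ∈ F) (hy : y ∈ F) :
    ({x, y} : Finset V) ∈ K :=
  hK.2 F hF _ (Finset.insert_subset hx (Finset.singleton_subset_iff.2 hy))

lemma exists_facet_mem {v : V} (hv : {v} ∈ K) : ∃ F ∈ facets K, v ∈ F := by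
  obtain ⟨F, hF, hvF⟩ := exists_isFacet hv
  exact ⟨F, mem_facets.2 hF, Finset.singleton_subset_iff.1 hvF⟩

lemma mem_of_mem_facets {F : Finset V} (hF : F ∈ facets K) : F ∈ K := (mem_facets.1 hF).1

lemma mem_facets_of_card_eq_two (hdim : HasDimCard K 2) {F : Finset V} (hF : F ∈ K)
    (hF2 : F.card = 2) : F ∈ facets K :=
  mem_facets.2 ⟨hF, fun G hG hFG => (Finset.eq_of_subset_of_card_le hFG
    ((hdim.2 G hG).trans hF2.ge)).symm⟩

lemma facets_nonempty (hdim : HasDimCard K 2) : (facets K).Nonempty := by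
  obtain ⟨F, hF, hF2⟩ := hdim.1
  exact ⟨F, mem_facets_of_card_eq_two hdim hF hF2⟩

lemma nonempty_of_mem_facets (hdim : HasDimCard K 2) : ∀ F ∈ facets K, F.Nonempty := by
  intro F hF
  by_contra h
  rw [Finset.not_nonempty_iff_eq_empty] at h
  obtain ⟨G, hG, hG2⟩ := hdim.1
  have := (mem_facets.1 hF).2 G hG (h ▸ Finset.empty_subset G)
  rw [this, h] at hG2
  simp at hG2

lemma isMatroidComplex_iff_edgeExchange (hK : IsComplex K) (hdim : HasDimCard K 2) :
    IsMatroidComplex K ↔ EdgeExchange K := by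
  constructor
  · intro h w i j hw hij hijK hwi hwj
    set W : Finset V := {w, i, j}
    have hcomp : IsFacet (inducedSub K W) {i, j} := by
      refine ⟨⟨hijK, by simp [W, Finset.subset_iff]⟩, fun G hG hle => ?_⟩
      refine (Finset.eq_of_subset_of_card_le hle ?_).symm
      rw [Finset.card_pair hij]
      exact hdim.2 G hG.1
    obtain ⟨G, hG, hwG⟩ := exists_isFacet (K := inducedSub K W) (G := {w}) ⟨hw, by simp [W]⟩
    have hcard : G.card = 2 := by rw [h W _ _ hG hcomp, Finset.card_pair hij]
    have hwG := Finset.singleton_subset_iff.1 hwG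
    obtain ⟨x, hxG, hxw⟩ := Finset.exists_mem_ne (by rw [hcard]; norm_num : 1 < G.card) w
    have hxW := hG.1.2 hxG
    have hwx := pair_mem hK hG.1.1 hwG hxG
    simp only [W, Finset.mem_insert, Finset.mem_singleton] at hxW
    rcases hxW with rfl | rfl | rfl
    · exact absurd rfl hxw
    · exact Or.inl hwx
    · exact Or.inr hwx
  · intro h W
    have key (F G : Finset V) (hF : IsFacet (inducedSub K W) F) (hG : IsFacet (inducedSub K W) G) :
        ¬ F.card < G.card := by
      intro hlt
      have hG2 := hdim.2 G hG.1.1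
      have hnsub : ¬ F ⊆ G := fun hle => by
        rw [hF.2 G hG.1 hle] at hlt
        exact lt_irrefl _ hlt
      have hF0 : F.card ≠ 0 := fun h0 => hnsub (by
        rw [Finset.card_eq_zero.1 h0]
        exact Finset.empty_subset G)
      obtain ⟨w, rfl⟩ := Finset.card_eq_one.1 (by lia : F.card = 1)
      obtain ⟨i, j, hij, rfl⟩ := Finset.card_eq_two.1
        (by rw [Finset.card_singleton] at hlt; lia : G.card = 2)
      have hw : w ∉ ({i, j} : Finset V) := fun hw => hnsub (Finset.singleton_subset_iff.2 hw)
      have hwi : w ≠ i := fun h => hw (by simp [h])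
      have hwj : w ≠ j := fun h => hw (by simp [h])
      have hmax (x : V) (hxw : w ≠ x) (hx : x ∈ W) : ({w, x} : Finset V) ∉ K := fun hwx => by
        have hwW := Finset.singleton_subset_iff.1 hF.1.2
        have := hF.2 {w, x} ⟨hwx, Finset.insert_subset hwW (Finset.singleton_subset_iff.2 hx)⟩
          (by simp)
        have := congrArg Finset.card this
        rw [Finset.card_pair hxw, Finset.card_singleton] at this
        lia
      rcases h w i j hF.1.1 hij hG.1.1 hwi hwj with h' | h'
      · exact hmax i hwi (hG.1.2 (by simp)) h'
      · exact hmax j hwj (hG.1.2 (by simp)) h'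
    intro F G hF hG
    exact le_antisymm (not_lt.1 (key G F hG hF)) (not_lt.1 (key F G hF hG))

lemma card_eq_two_of_isMatroidComplex (hdim : HasDimCard K 2) (h : IsMatroidComplex K) :
    ∀ F ∈ facets K, F.card = 2 := by
  intro F hF
  obtain ⟨G, hG, hG2⟩ := hdim.1
  have huniv : inducedSub K Finset.univ = K := by
    ext H
    simp [inducedSub]
  have hp := h Finset.univ
  rw [huniv] at hp
  rw [← hG2]
  exact hp F G (mem_facets.1 hF) (mem_facets.1 (mem_facets_of_card_eq_two hdim hG hG2))

/-- Reachability along edges of `K`. -/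
def Reach (K : Set (Finset V)) : V → V → Prop :=
  Relation.ReflTransGen fun a b : V => a ≠ b ∧ ({a, b} : Finset V) ∈ K

lemma reach_of_pair_mem {x y : V} (h : ({x, y} : Finset V) ∈ K) : Reach K x y := by
  by_cases hxy : x = y
  · rw [hxy]
    exact Relation.ReflTransGen.refl
  · exact Relation.ReflTransGen.single ⟨hxy, h⟩

lemma oneConnected_of_diamLE2 (h : diamLE2 K) : oneConnected K := by
  intro u w hu hw
  rcases h u w hu hw with rfl | h | ⟨z, h, h'⟩
  · exact Relation.ReflTransGen.refl
  · exact reach_of_pair_mem h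
  · exact (reach_of_pair_mem h).trans (reach_of_pair_mem h')

lemma card_eq_two_of_oneConnected (hK : IsComplex K) (hdim : HasDimCard K 2)
    (h : oneConnected K) : ∀ F ∈ facets K, F.card = 2 := by
  intro F hF
  have hle := hdim.2 F (mem_of_mem_facets hF)
  have hpos := (nonempty_of_mem_facets hdim F hF).card_pos
  by_contra hne
  obtain ⟨v, rfl⟩ := Finset.card_eq_one.1 (by lia : F.card = 1)
  have hmax (x : V) (hvx : v ≠ x) : ({v, x} : Finset V) ∉ K := fun hx => by
    have := congrArg Finset.card ((mem_facets.1 hF).2 _ hx (by simp))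
    rw [Finset.card_pair hvx, Finset.card_singleton] at this
    lia
  obtain ⟨G, hG, hG2⟩ := hdim.1
  obtain ⟨x, hx, hxv⟩ := Finset.exists_mem_ne (by rw [hG2]; norm_num : 1 < G.card) v
  have hxK : {x} ∈ K := hK.2 G hG _ (Finset.singleton_subset_iff.2 hx)
  rcases Relation.ReflTransGen.cases_head (h v x (mem_of_mem_facets hF) hxK) with h | ⟨y, hy, -⟩
  · exact hxv h.symm
  · exact hmax y hy.1 hy.2

end Graphs

section Weights

variable {V : Type} [Fintype V] [DecidableEq V] {K : Set (Finset V)} {k : Type} [Field k]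

lemma wt_add_wt_compl (F : Finset V) (a : V →₀ ℕ) : wt F a + wt Fᶜ a = wt Finset.univ a :=
  Finset.sum_add_sum_compl F _

lemma wt_compl_lt_iff {F : Finset V} {a : V →₀ ℕ} {ℓ : ℕ} :
    wt Fᶜ a < ℓ ↔ wt Finset.univ a < ℓ + wt F a := by
  rw [← wt_add_wt_compl F a]
  lia

lemma wt_pair {x y : V} (h : x ≠ y) (a : V →₀ ℕ) : wt {x, y} a = a x + a y :=
  Finset.sum_pair h

/-- To check that small edges are connected, it suffices to consider disjoint edges. -/
lemma weightConnected_of_disjoint (h2 : ∀ F ∈ facets K, F.card = 2) {ℓ : ℕ}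
    (h : ∀ (a : V →₀ ℕ) (c : V → k),
      (∀ x y, x ≠ y → ({x, y} : Finset V) ∈ facets K → wt Finset.univ a < ℓ + (a x + a y) →
        c x = c y) →
      ∀ p q r s, p ≠ q → r ≠ s → ({p, q} : Finset V) ∈ facets K → ({r, s} : Finset V) ∈ facets K →
        p ≠ r → p ≠ s → q ≠ r → q ≠ s → wt Finset.univ a < ℓ + (a p + a q) →
        wt Finset.univ a < ℓ + (a r + a s) → c p = c r) :
    WeightConnected k (facets K) ℓ := by
  intro a c hc F hF G hG hFa hGa i hi j hj
  by_cases hd : Disjoint F G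
  · obtain ⟨q, hq, hqi⟩ := Finset.exists_mem_ne (by rw [h2 F hF]; norm_num : 1 < F.card) i
    obtain ⟨s, hs, hsj⟩ := Finset.exists_mem_ne (by rw [h2 G hG]; norm_num : 1 < G.card) j
    have hF' : F = {i, q} := (Finset.eq_of_subset_of_card_le
      (Finset.insert_subset hi (Finset.singleton_subset_iff.2 hq))
      (by rw [h2 F hF, Finset.card_pair hqi.symm])).symm
    have hG' : G = {j, s} := (Finset.eq_of_subset_of_card_le
      (Finset.insert_subset hj (Finset.singleton_subset_iff.2 hs))
      (by rw [h2 G hG, Finset.card_pair hsj.symm])).symm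
    have hne {x y : V} (hx : x ∈ F) (hy : y ∈ G) : x ≠ y := fun hxy =>
      Finset.disjoint_left.1 hd hx (hxy ▸ hy)
    rw [wt_compl_lt_iff, hF', wt_pair hqi.symm] at hFa
    rw [wt_compl_lt_iff, hG', wt_pair hsj.symm] at hGa
    refine h a c (fun x y hxy hxyF hlt => ?_) i q j s hqi.symm hsj.symm (hF' ▸ hF) (hG' ▸ hG)
      (hne hi hj) (hne hi hs) (hne hq hj) (hne hq hs) hFa hGa
    refine hc _ hxyF ?_ x (by simp) y (by simp)
    rwa [wt_compl_lt_iff, wt_pair hxy]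
  · obtain ⟨x, hxF, hxG⟩ := Finset.not_disjoint_iff.1 hd
    exact (hc F hF hFa i hi x hxF).trans (hc G hG hGa x hxG j hj)

lemma weightConnected_of_isMatroidComplex (hK : IsComplex K) (hdim : HasDimCard K 2)
    (h : IsMatroidComplex K) (ℓ : ℕ) : WeightConnected k (facets K) ℓ := by
  have hex := (isMatroidComplex_iff_edgeExchange hK hdim).1 h
  refine weightConnected_of_disjoint (card_eq_two_of_isMatroidComplex hdim h) ?_
  intro a c hc p q r s hpq hrs hpqK hrsK hpr hps hqr hqs hpqa hrsa
  have hcp := hc p q hpq hpqK hpqa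
  have hcr := hc r s hrs hrsK hrsa
  have step (p q r s : V) (hpq : ({p, q} : Finset V) ∈ K) (hpqa : wt Finset.univ a < ℓ + (a p + a q))
      (hrs : r ≠ s) (hrsK : ({r, s} : Finset V) ∈ K) (hqr : q ≠ r) (hqs : q ≠ s)
      (hpr : a p ≤ a r) (hps : a p ≤ a s) : c q = c r ∨ c q = c s := by
    refine (hex q r s (hK.2 _ hpq _ (by simp)) hrs hrsK hqr hqs).imp (fun hmem => ?_) fun hmem => ?_
    · exact hc q r hqr (mem_facets_of_card_eq_two hdim hmem (Finset.card_pair hqr)) (by lia)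
    · exact hc q s hqs (mem_facets_of_card_eq_two hdim hmem (Finset.card_pair hqs)) (by lia)
  have hpqK' := mem_of_mem_facets hpqK
  have hrsK' := mem_of_mem_facets hrsK
  have hqpK : ({q, p} : Finset V) ∈ K := Finset.pair_comm p q ▸ hpqK'
  have hsrK : ({s, r} : Finset V) ∈ K := Finset.pair_comm r s ▸ hrsK'
  have hmin : (a p ≤ a r ∧ a p ≤ a s) ∨ (a q ≤ a r ∧ a q ≤ a s) ∨ (a r ≤ a p ∧ a r ≤ a q) ∨
      (a s ≤ a p ∧ a s ≤ a q) := by lia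
  rcases hmin with ⟨h1, h2⟩ | ⟨h1, h2⟩ | ⟨h1, h2⟩ | ⟨h1, h2⟩
  · rcases step p q r s hpqK' hpqa hrs hrsK' hqr hqs h1 h2 with h | h <;> simp_all
  · rcases step q p r s hqpK (by lia) hrs hrsK' hpr hps h1 h2 with h | h <;> simp_all
  · rcases step r s p q hrsK' hrsa hpq hpqK' hps.symm hqs.symm h1 h2 with h | h <;> simp_all
  · rcases step s r p q hsrK (by lia) hpq hpqK' hpr.symm hqr.symm h1 h2 with h | h <;> simp_all

lemma pair_add_pair_le_wt {p q r s : V} (hpq : p ≠ q) (hrs : r ≠ s) (hpr : p ≠ r) (hps : p ≠ s)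
    (hqr : q ≠ r) (hqs : q ≠ s) (a : V →₀ ℕ) :
    a p + a q + (a r + a s) ≤ wt Finset.univ a := by
  rw [← wt_pair hpq, ← wt_pair hrs, ← wt_add_wt_compl {p, q}]
  refine Nat.add_le_add_left (Finset.sum_le_sum_of_subset fun x hx => ?_) _
  simp only [Finset.mem_insert, Finset.mem_singleton] at hx
  rcases hx with rfl | rfl <;> simp [*, Ne.symm]

lemma weightConnected_one_of_oneConnected (hK : IsComplex K) (hdim : HasDimCard K 2)
    (h : oneConnected K) : WeightConnected k (facets K) 1 := by
  refine weightConnected_of_disjoint (card_eq_two_of_oneConnected hK hdim h) ?_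
  intro a c hc p q r s hpq hrs hpqK hrsK hpr hps hqr hqs hpqa hrsa
  have hle := pair_add_pair_le_wt hpq hrs hpr hps hqr hqs a
  have hreach : Reach K p r :=
    h p r (hK.2 _ (mem_of_mem_facets hpqK) _ (by simp)) (hK.2 _ (mem_of_mem_facets hrsK) _ (by simp))
  have key (x : V) (hx : Reach K p x) : c p = c x := by
    induction hx with
    | refl => rfl
    | tail _ hstep ih =>
      exact ih.trans (hc _ _ hstep.1
        (mem_facets_of_card_eq_two hdim hstep.2 (Finset.card_pair hstep.1)) (by lia))
  exact key r hreach

lemma weightConnected_two_of_diamLE2 (hK : IsComplex K) (hdim : HasDimCard K 2)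
    (h : diamLE2 K) : WeightConnected k (facets K) 2 := by
  refine weightConnected_of_disjoint
    (card_eq_two_of_oneConnected hK hdim (oneConnected_of_diamLE2 h)) ?_
  intro a c hc p q r s hpq hrs hpqK hrsK hpr hps hqr hqs hpqa hrsa
  have hle := pair_add_pair_le_wt hpq hrs hpr hps hqr hqs a
  have hedge (x y : V) (hxy : ({x, y} : Finset V) ∈ K)
      (hlt : wt Finset.univ a < 2 + (a x + a y)) : c x = c y := by
    by_cases hne : x = y
    · rw [hne]
    · exact hc x y hne (mem_facets_of_card_eq_two hdim hxy (Finset.card_pair hne)) hlt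
  have hdiam (x y : V) (hx : {x} ∈ K) (hy : {y} ∈ K) (hxa : wt Finset.univ a < 2 + a x)
      (hya : wt Finset.univ a < 2 + a y) : c x = c y := by
    rcases h x y hx hy with rfl | h | ⟨z, h, h'⟩
    · rfl
    · exact hedge x y h (by lia)
    · exact (hedge x z h (by lia)).trans (hedge z y h' (by lia))
  have hcp := hc p q hpq hpqK hpqa
  have hcr := hc r s hrs hrsK hrsa
  have hex (x y : V) (hxy : ({x, y} : Finset V) ∈ K) (hlt : wt Finset.univ a < 2 + (a x + a y))
      (hcxy : c x = c y) (hle : a x + a y ≤ 1) :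
      ∃ z, {z} ∈ K ∧ wt Finset.univ a < 2 + a z ∧ c x = c z := by
    by_cases h0 : a y = 0
    · exact ⟨x, hK.2 _ hxy _ (by simp), by lia, rfl⟩
    · exact ⟨y, hK.2 _ hxy _ (by simp), by lia, hcxy⟩
  obtain ⟨x, hx, hxa, hcx⟩ := hex p q (mem_of_mem_facets hpqK) hpqa hcp (by lia)
  obtain ⟨y, hy, hya, hcy⟩ := hex r s (mem_of_mem_facets hrsK) hrsa hcr (by lia)
  rw [hcx, hcy, hdiam x y hx hy hxa hya]

variable (k) in
/-- Both the depth and the Serre depth of the `ℓ`-th symbolic power are equal to `d`. -/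
def DepthsEq (K : Set (Finset V)) (ℓ d : ℕ) : Prop :=
  mdepth k (quotMod k (symbPow (srIdeal k K) ℓ)) = d ∧
    serreDepth k 2 (quotMod k (symbPow (srIdeal k K) ℓ)) = d

lemma depthsEq_two (hK : IsComplex K) (hdim : HasDimCard K 2) (h2 : ∀ F ∈ facets K, F.card = 2)
    {ℓ : ℕ} (hℓ : 1 ≤ ℓ) (hconn : WeightConnected k (facets K) ℓ) : DepthsEq k K ℓ 2 := by
  rw [DepthsEq, symbPow_srIdeal hK]
  exact ⟨mdepth_eq_two_of_weightConnected (facets_nonempty hdim) h2 hℓ hconn,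
    serreDepth_eq_two_of_weightConnected (facets_nonempty hdim) h2 hℓ hconn⟩

lemma depthsEq_one (hK : IsComplex K) (hdim : HasDimCard K 2) (c : Finset V → Prop) {ℓ : ℕ}
    (a : V →₀ ℕ) {F₀ G₀ : Finset V} (hF₀ : F₀ ∈ facets K) (hG₀ : G₀ ∈ facets K)
    (hF₀a : wt F₀ᶜ a < ℓ) (hG₀a : wt G₀ᶜ a < ℓ) (hF₀c : c F₀) (hG₀c : ¬ c G₀)
    (hdis : ∀ F ∈ facets K, ∀ G ∈ facets K, wt Fᶜ a < ℓ → wt Gᶜ a < ℓ → c F → ¬ c G →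
      ∀ x ∈ F, x ∉ G) : DepthsEq k K ℓ 1 := by
  rw [DepthsEq, symbPow_srIdeal hK]
  exact depth_eq_one_of_split (nonempty_of_mem_facets hdim) c a hF₀ hG₀ hF₀a hG₀a hF₀c hG₀c
    fun F hF G hG hFa hGa hFc hGc => Finset.disjoint_left.2 (hdis F hF G hG hFa hGa hFc hGc)

lemma depthsEq_one_of_not_oneConnected (hK : IsComplex K) (hdim : HasDimCard K 2)
    (h : ¬ oneConnected K) {ℓ : ℕ} (hℓ : 1 ≤ ℓ) : DepthsEq k K ℓ 1 := by
  unfold oneConnected at h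
  push Not at h
  obtain ⟨u, w, hu, hw, huw⟩ := h
  obtain ⟨F₀, hF₀, huF₀⟩ := exists_facet_mem hu
  obtain ⟨G₀, hG₀, hwG₀⟩ := exists_facet_mem hw
  have hreach {F : Finset V} (hF : F ∈ facets K) {x y : V} (hx : x ∈ F) (hy : y ∈ F) :
      Reach K x y := reach_of_pair_mem (pair_mem hK (mem_of_mem_facets hF) hx hy)
  have hwt (F : Finset V) : wt Fᶜ (0 : V →₀ ℕ) < ℓ := by
    have : wt Fᶜ (0 : V →₀ ℕ) = 0 := by simp [wt]
    lia
  refine depthsEq_one hK hdim (fun F => ∃ v ∈ F, Reach K u v) 0 hF₀ hG₀ (hwt _) (hwt _)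
    ⟨u, huF₀, Relation.ReflTransGen.refl⟩ ?_ ?_
  · rintro ⟨v, hv, huv⟩
    exact huw (huv.trans (hreach hG₀ hv hwG₀))
  · rintro F hF G hG - - ⟨v, hv, huv⟩ hGc x hxF hxG
    exact hGc ⟨x, hxG, huv.trans (hreach hF hv hxF)⟩

lemma depthsEq_one_of_not_diamLE2 (hK : IsComplex K) (hdim : HasDimCard K 2)
    (h : ¬ diamLE2 K) {ℓ : ℕ} (hℓ : 2 ≤ ℓ) : DepthsEq k K ℓ 1 := by
  unfold diamLE2 at h
  push Not at h
  obtain ⟨u, w, hu, hw, -, huwK, hz⟩ := h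
  obtain ⟨F₀, hF₀, huF₀⟩ := exists_facet_mem hu
  obtain ⟨G₀, hG₀, hwG₀⟩ := exists_facet_mem hw
  set a : V →₀ ℕ := Finsupp.single u (ℓ - 1) + Finsupp.single w (ℓ - 1) with ha
  have hnot {F : Finset V} (hF : F ∈ facets K) (huF : u ∈ F) (hwF : w ∈ F) : False :=
    huwK (pair_mem hK (mem_of_mem_facets hF) huF hwF)
  have hwt {F : Finset V} : wt Fᶜ a < ℓ ↔ u ∈ F ∨ w ∈ F := by
    rw [ha, wt_add, wt_single, wt_single]
    by_cases huF : u ∈ F <;> by_cases hwF : w ∈ F <;> simp [huF, hwF] <;> lia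
  refine depthsEq_one hK hdim (u ∈ ·) a hF₀ hG₀ (hwt.2 (Or.inl huF₀)) (hwt.2 (Or.inr hwG₀)) huF₀
    (fun huG₀ => hnot hG₀ huG₀ hwG₀) ?_
  intro F hF G hG _ hGa huF huG x hxF hxG
  have hwG := (hwt.1 hGa).resolve_left huG
  exact hz x (pair_mem hK (mem_of_mem_facets hF) huF hxF)
    (pair_mem hK (mem_of_mem_facets hG) hxG hwG)

lemma depthsEq_one_of_not_isMatroidComplex (hK : IsComplex K) (hdim : HasDimCard K 2)
    (h : ¬ IsMatroidComplex K) {ℓ : ℕ} (hℓ : 3 ≤ ℓ) : DepthsEq k K ℓ 1 := by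
  rw [isMatroidComplex_iff_edgeExchange hK hdim] at h
  unfold EdgeExchange at h
  push Not at h
  obtain ⟨w, i, j, hw, hij, hijK, hwi, hwj, hwiK, hwjK⟩ := h
  obtain ⟨F₀, hF₀, hwF₀⟩ := exists_facet_mem hw
  have hijF := mem_facets_of_card_eq_two hdim hijK (Finset.card_pair hij)
  have hw' : w ∉ ({i, j} : Finset V) := by simp [hwi, hwj]
  set a : V →₀ ℕ := Finsupp.single w (ℓ - 1) + (Finsupp.single i 1 + Finsupp.single j (ℓ - 2))
    with ha
  have hwt {F : Finset V} : wt Fᶜ a < ℓ ↔ w ∈ F ∨ (i ∈ F ∧ j ∈ F) := by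
    rw [ha, wt_add, wt_add, wt_single, wt_single, wt_single]
    by_cases hwF : w ∈ F <;> by_cases hiF : i ∈ F <;> by_cases hjF : j ∈ F <;>
      simp [hwF, hiF, hjF] <;> lia
  refine depthsEq_one hK hdim (w ∈ ·) a hF₀ hijF (hwt.2 (Or.inl hwF₀))
    (hwt.2 (Or.inr ⟨by simp, by simp⟩)) hwF₀ hw' ?_
  intro F hF G hG _ hGa hwF hwG x hxF hxG
  obtain ⟨hiG, hjG⟩ := (hwt.1 hGa).resolve_left hwG
  have hGeq := (mem_facets.1 hijF).2 G (mem_of_mem_facets hG)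
    (Finset.insert_subset hiG (Finset.singleton_subset_iff.2 hjG))
  have hwx := pair_mem hK (mem_of_mem_facets hF) hwF hxF
  rw [hGeq, Finset.mem_insert, Finset.mem_singleton] at hxG
  rcases hxG with rfl | rfl
  · exact hwiK hwx
  · exact hwjK hwx

lemma depthsEq_two_of_isMatroidComplex (hK : IsComplex K) (hdim : HasDimCard K 2)
    (h : IsMatroidComplex K) {ℓ : ℕ} (hℓ : 1 ≤ ℓ) : DepthsEq k K ℓ 2 :=
  depthsEq_two hK hdim (card_eq_two_of_isMatroidComplex hdim h) hℓ
    (weightConnected_of_isMatroidComplex hK hdim h ℓ)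

lemma depthsEq_two_of_oneConnected (hK : IsComplex K) (hdim : HasDimCard K 2)
    (h : oneConnected K) : DepthsEq k K 1 2 :=
  depthsEq_two hK hdim (card_eq_two_of_oneConnected hK hdim h) le_rfl
    (weightConnected_one_of_oneConnected hK hdim h)

lemma depthsEq_two_of_diamLE2 (hK : IsComplex K) (hdim : HasDimCard K 2)
    (h : diamLE2 K) : DepthsEq k K 2 2 :=
  depthsEq_two hK hdim (card_eq_two_of_oneConnected hK hdim (oneConnected_of_diamLE2 h))
    one_le_two (weightConnected_two_of_diamLE2 hK hdim h)

lemma exists_depthsEq (hK : IsComplex K) (hdim : HasDimCard K 2) {ℓ : ℕ} (hℓ : 1 ≤ ℓ) :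
    ∃ d, DepthsEq k K ℓ d := by
  by_cases hm : IsMatroidComplex K
  · exact ⟨2, depthsEq_two_of_isMatroidComplex hK hdim hm hℓ⟩
  by_cases hc : oneConnected K
  swap
  · exact ⟨1, depthsEq_one_of_not_oneConnected hK hdim hc hℓ⟩
  obtain rfl | hℓ := hℓ.eq_or_lt
  · exact ⟨2, depthsEq_two_of_oneConnected hK hdim hc⟩
  by_cases hd : diamLE2 K
  swap
  · exact ⟨1, depthsEq_one_of_not_diamLE2 hK hdim hd hℓ⟩
  obtain rfl | hℓ := (Nat.succ_le_of_lt hℓ).eq_or_lt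
  · exact ⟨2, depthsEq_two_of_diamLE2 hK hdim hd⟩
  · exact ⟨1, depthsEq_one_of_not_isMatroidComplex hK hdim hm hℓ⟩

end Weights

end

/-- Corollary `classify of the depth`: for a simplicial complex `Δ`
with `dim Δ = 1`, the sequence `(depth(S/I_Δ^(ℓ)))_{ℓ≥1}` is `(2,2,2,…)` if `Δ` is a
matroid; `(2,2,1,1,…)` if `diam Δ ≤ 2` and `Δ` is not a matroid; `(2,1,1,…)` if
`3 ≤ diam Δ < ∞`; and `(1,1,1,…)` if `diam Δ = ∞`.  Moreover, if `Δ` is pure, the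
sequence of `S_2`-Serre depths coincides with the sequence of depths. -/
theorem depth_symbPow_classification_of_dim_one
    (k : Type) [Field k] (n : ℕ)
    (K : Set (Finset (Fin n))) (hK : IsComplex K) (hdim : HasDimCard K 2) :
    (IsMatroidComplex K →
      ∀ ℓ : ℕ, 1 ≤ ℓ → mdepth k (quotMod k (symbPow (srIdeal k K) ℓ)) = 2) ∧
    (diamLE2 K → ¬ IsMatroidComplex K →
      mdepth k (quotMod k (symbPow (srIdeal k K) 1)) = 2 ∧
      mdepth k (quotMod k (symbPow (srIdeal k K) 2)) = 2 ∧
      ∀ ℓ : ℕ, 3 ≤ ℓ → mdepth k (quotMod k (symbPow (srIdeal k K) ℓ)) = 1) ∧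
    (oneConnected K → ¬ diamLE2 K →
      mdepth k (quotMod k (symbPow (srIdeal k K) 1)) = 2 ∧
      ∀ ℓ : ℕ, 2 ≤ ℓ → mdepth k (quotMod k (symbPow (srIdeal k K) ℓ)) = 1) ∧
    (¬ oneConnected K →
      ∀ ℓ : ℕ, 1 ≤ ℓ → mdepth k (quotMod k (symbPow (srIdeal k K) ℓ)) = 1) ∧
    (Pure K → ∀ ℓ : ℕ, 1 ≤ ℓ →
      serreDepth k 2 (quotMod k (symbPow (srIdeal k K) ℓ)) =
        mdepth k (quotMod k (symbPow (srIdeal k K) ℓ))) := by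
  refine ⟨fun hm ℓ hℓ => (depthsEq_two_of_isMatroidComplex hK hdim hm hℓ).1,
    fun hd hm => ⟨(depthsEq_two_of_oneConnected hK hdim (oneConnected_of_diamLE2 hd)).1,
      (depthsEq_two_of_diamLE2 hK hdim hd).1,
      fun ℓ hℓ => (depthsEq_one_of_not_isMatroidComplex hK hdim hm hℓ).1⟩,
    fun hc hd => ⟨(depthsEq_two_of_oneConnected hK hdim hc).1,
      fun ℓ hℓ => (depthsEq_one_of_not_diamLE2 hK hdim hd hℓ).1⟩,
    fun hc ℓ hℓ => (depthsEq_one_of_not_oneConnected hK hdim hc hℓ).1, fun _ ℓ hℓ => ?_⟩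
  obtain ⟨d, hd⟩ := exists_depthsEq (k := k) hK hdim hℓ
  rw [hd.1, hd.2]

end SerrePaper
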